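/- arXiv:1911.09136 — 3 statements merged into one kernel-verified Lean document; each statement's English description precedes it below -/
import Mathlib

section
/- Let f_1, …, f_k : ℕ → ℕ be functions given by polynomials with integer coefficients, and for each n let S_n ⊆ ℕ be the additive submonoid generated by f_1(n), …, f_k(n). Fix i ≥ 1. Then there is an eventually quasi-polynomial function g : ℕ → ℤ such that for every n for which ℕ \ S_n is finite, S_n ≠ {0}, and the Apéry set Ap(S_n) has at least i elements, the i-th smallest element of Ap(S_n) equals g(n). -/
/-- A function `c : ℕ → ℚ` is eventually periodic if there are `N` and `p ≥ 1`
with `c (n + p) = c n` for all `n ≥ N`. -/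
def EvPeriodic (c : ℕ → ℚ) : Prop :=
  ∃ N p : ℕ, 1 ≤ p ∧ ∀ n, N ≤ n → c (n + p) = c n

/-- A function `g : ℕ → ℤ` is eventually quasi-polynomial if
`g n = Σ_{i=0}^d c_i(n)·n^i` for eventually periodic `c_0, …, c_d : ℕ → ℚ`. -/
def IsEQP (g : ℕ → ℤ) : Prop :=
  ∃ (d : ℕ) (c : ℕ → ℕ → ℚ), (∀ i, i ≤ d → EvPeriodic (c i)) ∧
    ∀ n : ℕ, (g n : ℚ) = ∑ i ∈ Finset.range (d + 1), c i n * (n : ℚ) ^ i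

/-- The additive submonoid of `ℕ` generated by `f 0 n, …, f (k-1) n`. -/
def SG (k : ℕ) (f : Fin k → ℕ → ℕ) (n : ℕ) : AddSubmonoid ℕ :=
  AddSubmonoid.closure (Set.range fun i => f i n)

/-- The multiplicity of `SG k f n`: its smallest positive element. -/
noncomputable def mult (k : ℕ) (f : Fin k → ℕ → ℕ) (n : ℕ) : ℕ :=
  sInf {x : ℕ | x ∈ SG k f n ∧ 0 < x}

/-- The Apéry set of `SG k f n` (with respect to its multiplicity):
those `y ∈ S` with `y - m(S) ∉ S`, the subtraction being computed in `ℤ`. -/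
def Ap (k : ℕ) (f : Fin k → ℕ → ℕ) (n : ℕ) : Set ℕ :=
  {y : ℕ | y ∈ SG k f n ∧ ∀ s ∈ SG k f n, (s : ℤ) ≠ (y : ℤ) - (mult k f n : ℤ)}

open Polynomial

/-- On a semilinear set where every linear form is `O(ν)`, an equation between base-`ν`
expansions with affine digits has a semilinear solution set: only finitely many carries can
occur at each place. -/
theorem isSemilinearSet_sum_pow_mul_eq {M : Type*} [AddCommMonoid M] [AddMonoid.FG M]
    (ν : M →+ ℕ) {R : Set M} (hR : IsSemilinearSet R) (hpos : ∀ v ∈ R, 1 ≤ ν v)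
    (hbd : ∀ φ : M →+ ℤ, ∃ C : ℤ, ∀ v ∈ R, |φ v| ≤ C * ν v)
    (E : ℕ) (e : ℕ → M →+ ℤ) (c : ℕ → ℤ) (t : ℤ) :
    IsSemilinearSet
      {v | v ∈ R ∧ ∑ s ∈ Finset.range E, (ν v : ℤ) ^ s * (e s v + c s) = t} := by
  induction E generalizing e c t with
  | zero =>
    by_cases ht : t = 0
    · simpa [ht] using hR
    · simp [Ne.symm ht]
  | succ E ih =>
    obtain ⟨C, hC⟩ := hbd (e 0)
    set B : ℤ := C + |c 0 - t| with hB
    have key : {v | v ∈ R ∧ ∑ s ∈ Finset.range (E + 1), (ν v : ℤ) ^ s * (e s v + c s) = t} =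
        ⋃ u ∈ Finset.Icc (-B) B,
          {v | c 0 + e 0 v = t + (-u • (Nat.castAddMonoidHom ℤ).comp ν) v} ∩
          {v | v ∈ R ∧ ∑ s ∈ Finset.range E, (ν v : ℤ) ^ s * (e (s + 1) v + c (s + 1)) = u} := by
      ext v
      simp only [Set.mem_ofPred_eq, Set.mem_iUnion, Set.mem_inter_iff, Finset.mem_Icc,
        Finset.sum_range_succ', exists_prop]
      have hs : ∑ s ∈ Finset.range E, (ν v : ℤ) ^ (s + 1) * (e (s + 1) v + c (s + 1)) =
          ν v * ∑ s ∈ Finset.range E, (ν v : ℤ) ^ s * (e (s + 1) v + c (s + 1)) := by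
        rw [Finset.mul_sum]
        exact Finset.sum_congr rfl fun s _ => by ring
      rw [hs]
      simp only [AddMonoidHom.smul_apply, AddMonoidHom.coe_comp, Function.comp_apply,
        Nat.coe_castAddMonoidHom, smul_eq_mul, pow_zero, one_mul]
      set T := ∑ s ∈ Finset.range E, (ν v : ℤ) ^ s * (e (s + 1) v + c (s + 1))
      constructor
      · rintro ⟨hv, h⟩
        refine ⟨T, ?_, by linarith, hv, rfl⟩
        have hn : (1 : ℤ) ≤ ν v := by exact_mod_cast hpos v hv
        have h1 : |T| * ν v ≤ B * ν v := by
          have h2 : |T| * ν v = |e 0 v + (c 0 - t)| := by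
            rw [← Nat.abs_cast (ν v), ← abs_mul, ← abs_neg]
            congr 1
            linarith
          have h3 := abs_add_le (e 0 v) (c 0 - t)
          have h4 := hC v hv
          have h5 : |c 0 - t| ≤ |c 0 - t| * ν v := le_mul_of_one_le_right (abs_nonneg _) hn
          rw [h2, hB, add_mul]
          linarith
        exact abs_le.1 (le_of_mul_le_mul_right h1 (by linarith))
      · rintro ⟨u, -, h, hv, hT⟩
        refine ⟨hv, ?_⟩
        rw [hT]
        linarith
    rw [key]
    exact IsSemilinearSet.biUnion_finset fun u _ =>
      (isSemilinearSet_setOfPred_eq _ _ _ _).inter (ih _ _ _)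

theorem exists_digits_le (n D b : ℕ) (hn : 1 ≤ n) (hb : b < n ^ D) :
    ∃ d : Fin D → ℕ, (∀ l, d l ≤ n) ∧ b = ∑ l, d l * n ^ (l : ℕ) := by
  induction D generalizing b with
  | zero => exact ⟨fun _ => 0, by simp, by simpa using hb⟩
  | succ D ih =>
    obtain ⟨d, hd, h⟩ := ih (b / n) (by
      rw [Nat.div_lt_iff_lt_mul hn]
      simpa [pow_succ] using hb)
    refine ⟨Fin.cons (b % n) d, ?_, ?_⟩
    · intro l
      refine Fin.cases ?_ (fun l => ?_) l
      · simpa using (Nat.mod_lt b hn).le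
      · simpa using hd l
    · have h2 : ∑ l, d l * n ^ ((l : ℕ) + 1) = n * (b / n) := by
        rw [h, Finset.mul_sum]
        exact Finset.sum_congr rfl fun l _ => by ring
      simp [Fin.sum_univ_succ, h2, Nat.mod_add_div]

theorem exists_forall_eval_lt_pow (h : ℤ[X]) :
    ∃ D N : ℕ, ∀ n : ℕ, N ≤ n → h.eval (n : ℤ) < (n : ℤ) ^ D := by
  refine ⟨h.natDegree + 1, (∑ s ∈ Finset.range (h.natDegree + 1), |h.coeff s|).toNat + 1,
    fun n hn => ?_⟩
  have hn1 : (1 : ℤ) ≤ n := by exact_mod_cast (by omega : 1 ≤ n)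
  have hn2 : ∑ s ∈ Finset.range (h.natDegree + 1), |h.coeff s| < (n : ℤ) := by omega
  rw [eval_eq_sum_range]
  calc ∑ s ∈ Finset.range (h.natDegree + 1), h.coeff s * (n : ℤ) ^ s
      ≤ ∑ s ∈ Finset.range (h.natDegree + 1), |h.coeff s| * (n : ℤ) ^ h.natDegree := by
        refine Finset.sum_le_sum fun s hs => ?_
        refine mul_le_mul (le_abs_self _) (pow_le_pow_right₀ hn1 ?_) (by positivity) (abs_nonneg _)
        simpa [Nat.lt_succ_iff] using hs
    _ = (∑ s ∈ Finset.range (h.natDegree + 1), |h.coeff s|) * (n : ℤ) ^ h.natDegree := by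
        rw [Finset.sum_mul]
    _ < n * (n : ℤ) ^ h.natDegree := mul_lt_mul_of_pos_right hn2 (by positivity)
    _ = (n : ℤ) ^ (h.natDegree + 1) := by ring

theorem IsSemilinearSet.congr_of_le {P Q : ℕ → Prop} (N : ℕ)
    (hPQ : ∀ n, N ≤ n → (P n ↔ Q n)) (hP : IsSemilinearSet {n | P n}) :
    IsSemilinearSet {n | Q n} := by
  rw [Nat.isSemilinearSet_iff_ultimately_periodic] at hP ⊢
  obtain ⟨K, p, hp, h⟩ := hP
  refine ⟨max K N, p, hp, fun x hx => ?_⟩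
  have := h x (by omega)
  simp only [Set.mem_ofPred_eq] at this ⊢
  rw [← hPQ x (by omega), ← hPQ (x + p) (by omega)]
  exact this

theorem isSemilinearSet_exists_digits_sum_eq {k : ℕ} (p : Fin k → ℤ[X]) (h : ℤ[X]) (D : ℕ) :
    IsSemilinearSet {n : ℕ | 1 ≤ n ∧ ∃ d : Fin k → Fin D → ℕ, (∀ j l, d j l ≤ n) ∧
      ∑ j, ((∑ l, d j l * n ^ (l : ℕ) : ℕ) : ℤ) * (p j).eval (n : ℤ) = h.eval (n : ℤ)} := by
  let κ := Fin k × Fin D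
  let ν : (Option κ → ℕ) →+ ℕ := Pi.evalAddMonoidHom (fun _ => ℕ) none
  let R : Set (Option κ → ℕ) := {v | 1 ≤ v none ∧ ∀ j, v j ≤ v none}
  have hR : IsSemilinearSet R := by
    have h1 : IsSemilinearSet {v : Option κ → ℕ | 1 ≤ v none} := by
      have : {v : Option κ → ℕ | 1 ≤ v none} = ν ⁻¹' {0}ᶜ := by
        ext v
        simp [ν, Nat.one_le_iff_ne_zero]
      rw [this]
      exact (IsSemilinearSet.singleton 0).compl.preimage ν
    have h2 (j : Option κ) : IsSemilinearSet {v : Option κ → ℕ | v j ≤ v none} := by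
      have : {v : Option κ → ℕ | v j ≤ v none} =
          {v | ∃ y : Unit → ℕ, v j + y () = v none} := by
        ext v
        simp only [Set.mem_ofPred_eq, le_iff_exists_add]
        exact ⟨fun ⟨c, hc⟩ => ⟨fun _ => c, hc.symm⟩, fun ⟨y, hy⟩ => ⟨y (), hy.symm⟩⟩
      rw [this]
      apply IsSemilinearSet.proj'
      have := isSemilinearSet_setOfPred_eq (M := Option κ ⊕ Unit → ℕ) (0 : ℕ) 0
        (Pi.evalAddMonoidHom (fun _ => ℕ) (Sum.inl j) +
          Pi.evalAddMonoidHom (fun _ => ℕ) (Sum.inr ()))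
        (Pi.evalAddMonoidHom (fun _ => ℕ) (Sum.inl none))
      simpa using this
    have h3 := h1.inter (IsSemilinearSet.iInter h2)
    convert h3 using 1
    ext v
    simp [R]
  have hbd (φ : (Option κ → ℕ) →+ ℤ) : ∃ C : ℤ, ∀ v ∈ R, |φ v| ≤ C * ν v := by
    refine ⟨∑ j, |φ (Pi.single j 1)|, fun v hv => ?_⟩
    have hv' : v = ∑ j, v j • Pi.single j 1 := by
      ext j
      simp [Finset.sum_apply, Pi.single_apply]
    have : φ v = ∑ j, (v j : ℤ) * φ (Pi.single j 1) := by
      conv_lhs => rw [hv', map_sum]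
      exact Finset.sum_congr rfl fun j _ => by rw [map_nsmul, nsmul_eq_mul]
    rw [this, Finset.sum_mul]
    refine (Finset.abs_sum_le_sum_abs _ _).trans (Finset.sum_le_sum fun j _ => ?_)
    rw [abs_mul, mul_comm, Nat.abs_cast]
    exact mul_le_mul_of_nonneg_left (by exact_mod_cast hv.2 j) (abs_nonneg _)
  let E := (∑ jl : κ, (X ^ (jl.2 : ℕ) * p jl.1).natDegree) + h.natDegree + 1
  let e : ℕ → (Option κ → ℕ) →+ ℤ := fun s => ∑ jl : κ,
    (X ^ (jl.2 : ℕ) * p jl.1).coeff s •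
      (Nat.castAddMonoidHom ℤ).comp (Pi.evalAddMonoidHom (fun _ => ℕ) (some jl))
  have hmain := (isSemilinearSet_sum_pow_mul_eq ν hR (fun v hv => hv.1) hbd E e
    (fun s => - h.coeff s) 0).image ν
  convert hmain using 1
  have hsum (v : Option κ → ℕ) :
      ∑ s ∈ Finset.range E, (ν v : ℤ) ^ s * (e s v + - h.coeff s) =
      ∑ j, ((∑ l, v (some (j, l)) * v none ^ (l : ℕ) : ℕ) : ℤ) * (p j).eval (v none : ℤ) -
        h.eval (v none : ℤ) := by
    have hh : h.eval (v none : ℤ) = ∑ s ∈ Finset.range E, h.coeff s * (v none : ℤ) ^ s :=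
      eval_eq_sum_range' (by omega) _
    have hjl (jl : κ) : (v none : ℤ) ^ (jl.2 : ℕ) * (p jl.1).eval (v none : ℤ) =
        ∑ s ∈ Finset.range E, (X ^ (jl.2 : ℕ) * p jl.1).coeff s * (v none : ℤ) ^ s := by
      rw [← eval_eq_sum_range' (n := E)]
      · simp
      · have := Finset.single_le_sum
          (f := fun jl : κ => (X ^ (jl.2 : ℕ) * p jl.1).natDegree) (fun _ _ => Nat.zero_le _)
          (Finset.mem_univ jl)
        simp only [E]
        omega
    have hl : ∑ j, ((∑ l, v (some (j, l)) * v none ^ (l : ℕ) : ℕ) : ℤ) *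
        (p j).eval (v none : ℤ) = ∑ jl : κ, (v (some jl) : ℤ) *
          ((v none : ℤ) ^ (jl.2 : ℕ) * (p jl.1).eval (v none : ℤ)) := by
      rw [Fintype.sum_prod_type]
      refine Finset.sum_congr rfl fun j _ => ?_
      push_cast
      rw [Finset.sum_mul]
      exact Finset.sum_congr rfl fun l _ => by ring
    rw [hl, hh]
    simp_rw [hjl, Finset.mul_sum]
    rw [Finset.sum_comm, ← Finset.sum_sub_distrib]
    refine Finset.sum_congr rfl fun s _ => ?_
    have hes : e s v = ∑ jl : κ, (X ^ (jl.2 : ℕ) * p jl.1).coeff s * (v (some jl) : ℤ) := by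
      simp only [e, AddMonoidHom.finsetSum_apply, AddMonoidHom.smul_apply,
        AddMonoidHom.coe_comp, Function.comp_apply, Nat.coe_castAddMonoidHom,
        Pi.evalAddMonoidHom_apply, smul_eq_mul]
    rw [hes, mul_add, Finset.mul_sum]
    have hν : (ν v : ℤ) = v none := rfl
    rw [hν, sub_eq_add_neg]
    congr 1
    · exact Finset.sum_congr rfl fun jl _ => by ring
    · ring
  ext n
  simp only [Set.mem_ofPred_eq, Set.mem_image, hsum]
  constructor
  · rintro ⟨hn, d, hd, h⟩
    refine ⟨fun o => o.elim n fun jl => d jl.1 jl.2, ⟨⟨hn, ?_⟩, ?_⟩, rfl⟩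
    · rintro (_ | ⟨j, l⟩)
      · exact le_rfl
      · exact hd j l
    · exact sub_eq_zero.2 h
  · rintro ⟨v, ⟨hv, h⟩, rfl⟩
    exact ⟨hv.1, fun j l => v (some (j, l)), fun j l => hv.2 _, sub_eq_zero.1 h⟩

/-- The set of `n` for which `h(n)` lies in the monoid generated by the `p_j(n)` is semilinear. -/
theorem isSemilinearSet_exists_sum_mul_eval_eq {k : ℕ} (p : Fin k → ℤ[X])
    (hp : ∀ j (n : ℕ), 0 ≤ (p j).eval (n : ℤ)) (h : ℤ[X]) :
    IsSemilinearSet {n : ℕ | ∃ b : Fin k → ℕ,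
      ∑ j, (b j : ℤ) * (p j).eval (n : ℤ) = h.eval (n : ℤ)} := by
  obtain ⟨D, N, hD⟩ := exists_forall_eval_lt_pow h
  refine (isSemilinearSet_exists_digits_sum_eq p h D).congr_of_le (N + 1) fun n hn => ?_
  constructor
  · rintro ⟨-, d, -, hd⟩
    exact ⟨_, hd⟩
  · rintro ⟨b, hb⟩
    refine ⟨by omega, ?_⟩
    have hlt (j) : (if (p j).eval (n : ℤ) = 0 then 0 else b j) < n ^ D := by
      split_ifs with h0
      · exact pow_pos (by omega) _
      · have h1 : (b j : ℤ) * (p j).eval (n : ℤ) ≤ h.eval (n : ℤ) := by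
          rw [← hb]
          exact Finset.single_le_sum (f := fun j => (b j : ℤ) * (p j).eval (n : ℤ))
            (fun j _ => mul_nonneg (by positivity) (hp j n)) (Finset.mem_univ j)
        have h2 : (b j : ℤ) ≤ (b j : ℤ) * (p j).eval (n : ℤ) :=
          le_mul_of_one_le_right (by positivity) (by have := hp j n; omega)
        have h3 := hD n (by omega)
        exact_mod_cast (by linarith : (b j : ℤ) < (n : ℤ) ^ D)
    choose d hd hbd using fun j => exists_digits_le n D _ (by omega) (hlt j)
    refine ⟨d, hd, ?_⟩
    rw [← hb]
    refine Finset.sum_congr rfl fun j _ => ?_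
    rw [← hbd j]
    split_ifs with h0 <;> simp [h0]

theorem isSemilinearSet_eval_le_eval (p q : ℤ[X]) :
    IsSemilinearSet {n : ℕ | p.eval (n : ℤ) ≤ q.eval (n : ℤ)} := by
  convert isSemilinearSet_exists_sum_mul_eval_eq (k := 1) (fun _ => 1) (by simp) (q - p) using 1
  ext n
  simp only [Set.mem_ofPred_eq, Finset.univ_unique, Finset.sum_singleton, eval_one, mul_one,
    eval_sub]
  constructor
  · intro h
    exact ⟨fun _ => (q.eval (n : ℤ) - p.eval (n : ℤ)).toNat, by
      rw [Int.toNat_of_nonneg (by linarith)]⟩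
  · rintro ⟨b, hb⟩
    have : (0 : ℤ) ≤ b default := by positivity
    linarith

theorem exists_common_period {α : Type*} [Finite α] (Q : α → ℕ → Prop)
    (hQ : ∀ a, IsSemilinearSet {n | Q a n}) :
    ∃ N p : ℕ, 1 ≤ p ∧ ∀ n, N ≤ n → ∀ a, Q a (n + p) ↔ Q a n := by
  have := Fintype.ofFinite α
  choose N p hp h using fun a => Nat.isSemilinearSet_iff_ultimately_periodic.1 (hQ a)
  have hmul (a : α) (t n : ℕ) (hn : N a ≤ n) : Q a (n + t * p a) ↔ Q a n := by
    induction t with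
    | zero => simp
    | succ t ih =>
      rw [← ih, add_mul, one_mul, ← add_assoc]
      exact (h a (n + t * p a) (by omega)).symm
  refine ⟨∑ a, N a, ∏ a, p a, Finset.prod_pos fun a _ => hp a, fun n hn a => ?_⟩
  obtain ⟨t, ht⟩ := Finset.dvd_prod_of_mem p (Finset.mem_univ a)
  rw [ht, mul_comm]
  exact hmul a t n ((Finset.single_le_sum (fun _ _ => Nat.zero_le _) (Finset.mem_univ a)).trans hn)

namespace IsSemilinearSet

variable {P Q : ℕ → Prop}

theorem not (hP : IsSemilinearSet {n | P n}) : IsSemilinearSet {n | ¬ P n} := by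
  exact hP.compl

theorem and (hP : IsSemilinearSet {n | P n}) (hQ : IsSemilinearSet {n | Q n}) :
    IsSemilinearSet {n | P n ∧ Q n} := by
  exact hP.inter hQ

theorem imp (hP : IsSemilinearSet {n | P n}) (hQ : IsSemilinearSet {n | Q n}) :
    IsSemilinearSet {n | P n → Q n} := by
  convert hP.compl.union hQ using 1
  ext n
  simp [imp_iff_not_or]

theorem exists_finite {α : Type*} [Finite α] {P : α → ℕ → Prop}
    (hP : ∀ a, IsSemilinearSet {n | P a n}) : IsSemilinearSet {n | ∃ a, P a n} := by
  convert IsSemilinearSet.iUnion hP using 1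
  ext n
  simp

theorem forall_finite {α : Type*} [Finite α] {P : α → ℕ → Prop}
    (hP : ∀ a, IsSemilinearSet {n | P a n}) : IsSemilinearSet {n | ∀ a, P a n} := by
  convert IsSemilinearSet.iInter hP using 1
  ext n
  simp

theorem const (P : Prop) : IsSemilinearSet {_n : ℕ | P} := by
  by_cases h : P <;> simp [h]

end IsSemilinearSet

theorem ncard_lt_eq_iff_exists_finset {α : Type*} (S : Set ℕ) (y : α → ℕ) (r x : ℕ)
    (hy : ∀ z ∈ S, {w ∈ S | w < z}.ncard ≤ r → ∃ b, y b = z) :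
    {w ∈ S | w < x}.ncard = r ↔
      ∃ T : Finset α, T.card = r ∧ (∀ b ∈ T, y b ∈ S ∧ y b < x) ∧
        (∀ b ∈ T, ∀ c ∈ T, y b = y c → b = c) ∧
        ∀ c, y c ∈ S → y c < x → ∃ b ∈ T, y b = y c := by
  classical
  have hfin (z : ℕ) : {w ∈ S | w < z}.Finite := (Set.finite_lt_nat z).subset fun w hw => hw.2
  constructor
  · intro hr
    have hex (z : {w ∈ S | w < x}) : ∃ b, y b = z :=
      hy z z.2.1 (hr ▸ Set.ncard_le_ncard (fun w hw => ⟨hw.1, hw.2.trans z.2.2⟩) (hfin x))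
    choose g hg using hex
    have := (hfin x).fintype
    refine ⟨Finset.univ.image g, ?_, ?_, ?_, ?_⟩
    · rw [Finset.card_image_of_injective, Finset.card_univ, ← Nat.card_eq_fintype_card,
        Nat.card_coe_set_eq, hr]
      intro z w h
      rw [Subtype.ext_iff, ← hg z, ← hg w, h]
    · intro b hb
      obtain ⟨z, -, rfl⟩ := Finset.mem_image.1 hb
      rw [hg z]
      exact z.2
    · intro b hb c hc h
      obtain ⟨z, -, rfl⟩ := Finset.mem_image.1 hb
      obtain ⟨w, -, rfl⟩ := Finset.mem_image.1 hc
      rw [hg z, hg w] at h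
      rw [Subtype.ext h]
    · intro c hc hcx
      exact ⟨g ⟨y c, hc, hcx⟩, Finset.mem_image_of_mem _ (Finset.mem_univ _), hg _⟩
  · rintro ⟨T, hT, hTS, hinj, hcov⟩
    have hsub (z : ℕ) (hz : z ∈ S) (hzx : z < x) : z ∈ T.image y := by
      induction z using Nat.strong_induction_on with
      | _ z ih =>
        have hle : {w ∈ S | w < z}.ncard ≤ r := by
          rw [← hT]
          refine le_trans ?_ (Finset.card_image_le (s := T) (f := y))
          rw [← Set.ncard_coe_finset]
          exact Set.ncard_le_ncard (fun w hw => ih w hw.2 hw.1 (hw.2.trans hzx))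
            (Finset.finite_toSet _)
        obtain ⟨c, rfl⟩ := hy z hz hle
        obtain ⟨b, hb, h⟩ := hcov c hz hzx
        exact Finset.mem_image.2 ⟨b, hb, h⟩
    have heq : {w ∈ S | w < x} = ↑(T.image y) := by
      ext z
      refine ⟨fun hz => hsub z hz.1 hz.2, fun hz => ?_⟩
      obtain ⟨b, hb, rfl⟩ := Finset.mem_image.1 (Finset.mem_coe.1 hz)
      exact hTS b hb
    rw [heq, Set.ncard_coe_finset, Finset.card_image_of_injOn, hT]
    exact fun b hb c hc h => hinj b hb c hc h

theorem exists_mem_ncard_lt_eq {S : Set ℕ} {r : ℕ} (hr : r < S.ncard) :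
    ∃ x ∈ S, {w ∈ S | w < x}.ncard = r := by
  classical
  have hcard (hf : (Set.ofPred (· ∈ S)).Finite) : r < hf.toFinset.card := by
    rwa [← Set.ncard_eq_toFinset_card _ hf]
  refine ⟨Nat.nth (· ∈ S) r, Nat.nth_mem r hcard, ?_⟩
  have hcount := Nat.count_nth hcard
  rw [Nat.count_eq_card_filter_range, ← Set.ncard_coe_finset] at hcount
  refine Eq.trans ?_ hcount
  congr 1
  ext w
  simp [and_comm]

section Semigroup

variable {k : ℕ} {f : Fin k → ℕ → ℕ} {n : ℕ}

theorem mem_SG_iff {x : ℕ} : x ∈ SG k f n ↔ ∃ b : Fin k → ℕ, ∑ j, b j * f j n = x := by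
  rw [SG, AddSubmonoid.mem_closure_range_iff_of_fintype]
  simp [eq_comm]

/-- `f j n` is the smallest positive generator of `SG k f n`. -/
def IsMinGen (f : Fin k → ℕ → ℕ) (j : Fin k) (n : ℕ) : Prop :=
  0 < f j n ∧ ∀ l, 0 < f l n → f j n ≤ f l n

theorem exists_isMinGen (h : SG k f n ≠ ⊥) : ∃ j, IsMinGen f j n := by
  have hne : (Finset.univ.filter fun j => 0 < f j n).Nonempty := by
    by_contra hcon
    rw [Finset.not_nonempty_iff_eq_empty, Finset.filter_eq_empty_iff] at hcon
    refine h ((AddSubmonoid.eq_bot_iff_forall _).2 fun x hx => ?_)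
    obtain ⟨b, rfl⟩ := mem_SG_iff.1 hx
    refine Finset.sum_eq_zero fun j hj => ?_
    rw [Nat.eq_zero_of_not_pos (hcon hj), mul_zero]
  obtain ⟨j, hj, hmin⟩ := Finset.exists_min_image _ (fun j => f j n) hne
  exact ⟨j, (Finset.mem_filter.1 hj).2, fun l hl => hmin l (by simp [hl])⟩

theorem mem_SG_generator (j : Fin k) : f j n ∈ SG k f n :=
  AddSubmonoid.subset_closure ⟨j, rfl⟩

theorem IsMinGen.mult_eq {j : Fin k} (h : IsMinGen f j n) : mult k f n = f j n := by
  refine le_antisymm (Nat.sInf_le ⟨mem_SG_generator j, h.1⟩) ?_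
  refine le_csInf ⟨f j n, mem_SG_generator j, h.1⟩ ?_
  rintro x ⟨hx, hpos⟩
  obtain ⟨b, rfl⟩ := mem_SG_iff.1 hx
  obtain ⟨l, hl, hne⟩ := Finset.exists_ne_zero_of_sum_ne_zero hpos.ne'
  refine (h.2 l (Nat.pos_of_ne_zero (right_ne_zero_of_mul hne))).trans ?_
  exact (Nat.le_mul_of_pos_left _ (Nat.pos_of_ne_zero (left_ne_zero_of_mul hne))).trans
    (Finset.single_le_sum (f := fun l => b l * f l n) (fun _ _ => Nat.zero_le _) hl)

theorem mem_Ap_iff (h : SG k f n ≠ ⊥) (a : Fin k → ℕ) :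
    ∑ j, a j * f j n ∈ Ap k f n ↔ ∀ j, IsMinGen f j n →
      ¬ ∃ b : Fin k → ℕ,
        ∑ l, (b l : ℤ) * (f l n : ℤ) = ((∑ l, a l * f l n : ℕ) : ℤ) - (f j n : ℤ) := by
  constructor
  · rintro ⟨-, h⟩ j hj ⟨b, hb⟩
    refine h _ (mem_SG_iff.2 ⟨b, rfl⟩) ?_
    rw [hj.mult_eq, ← hb]
    push_cast
    rfl
  · intro h'
    refine ⟨mem_SG_iff.2 ⟨a, rfl⟩, fun s hs heq => ?_⟩
    obtain ⟨j, hj⟩ := exists_isMinGen h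
    obtain ⟨b, rfl⟩ := mem_SG_iff.1 hs
    refine h' j hj ⟨b, ?_⟩
    rw [hj.mult_eq] at heq
    rw [← heq]
    push_cast
    rfl

theorem mem_Ap_of_add_mem_Ap {s t : ℕ} (hs : s ∈ SG k f n) (ht : t ∈ SG k f n)
    (h : s + t ∈ Ap k f n) : s ∈ Ap k f n := by
  refine ⟨hs, fun u hu heq => h.2 (u + t) (add_mem hu ht) ?_⟩
  push_cast
  linarith

theorem coeff_le_ncard_of_mem_Ap {b : Fin k → ℕ} (hb : ∑ l, b l * f l n ∈ Ap k f n)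
    {j : Fin k} (hj : f j n ≠ 0) :
    b j ≤ {w ∈ Ap k f n | w < ∑ l, b l * f l n}.ncard := by
  classical
  set x := ∑ l, b l * f l n
  set rest := ∑ l ∈ Finset.univ.erase j, b l * f l n
  have hxr : x = b j * f j n + rest := (Finset.add_sum_erase _ _ (Finset.mem_univ j)).symm
  have hgen (t : ℕ) : t * f j n ∈ SG k f n := by
    simpa using nsmul_mem (mem_SG_generator (f := f) (n := n) j) t
  have hrmem : rest ∈ SG k f n := sum_mem fun l _ => by
    simpa using nsmul_mem (mem_SG_generator (f := f) (n := n) l) (b l)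
  have hfin : {w ∈ Ap k f n | w < x}.Finite := (Set.finite_lt_nat x).subset fun w hw => hw.2
  have hsub : (↑((Finset.range (b j)).image fun t => t * f j n + rest) : Set ℕ) ⊆
      {w ∈ Ap k f n | w < x} := by
    intro w hw
    obtain ⟨t, ht, rfl⟩ := Finset.mem_image.1 (Finset.mem_coe.1 hw)
    have htb := Finset.mem_range.1 ht
    refine ⟨mem_Ap_of_add_mem_Ap (add_mem (hgen t) hrmem) (hgen (b j - t)) ?_, ?_⟩
    · convert hb using 1
      rw [hxr, add_right_comm, ← add_mul, Nat.add_sub_cancel' htb.le]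
    · rw [hxr]
      exact Nat.add_lt_add_right (Nat.mul_lt_mul_of_pos_right htb (Nat.pos_of_ne_zero hj)) _
  have hcard := Set.ncard_le_ncard hsub hfin
  rwa [Set.ncard_coe_finset, Finset.card_image_of_injective, Finset.card_range] at hcard
  intro t u htu
  exact Nat.eq_of_mul_eq_mul_right (Nat.pos_of_ne_zero hj) (Nat.add_right_cancel htu)

theorem exists_coeff_lt_of_mem_Ap {x i : ℕ} (hx : x ∈ Ap k f n)
    (hi : {w ∈ Ap k f n | w < x}.ncard < i) :
    ∃ a : Fin k → Fin i, ∑ j, (a j : ℕ) * f j n = x := by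
  obtain ⟨b, rfl⟩ := mem_SG_iff.1 hx.1
  refine ⟨fun j => if h : f j n = 0 then ⟨0, by omega⟩ else
    ⟨b j, (coeff_le_ncard_of_mem_Ap hx h).trans_lt hi⟩, ?_⟩
  refine Finset.sum_congr rfl fun j _ => ?_
  by_cases h : f j n = 0 <;> simp [h]

variable (f) in
/-- At `n`, the combination of the generators with coefficients `a` lies in the Apéry set
(provided `SG k f n ≠ ⊥`). -/
def CombInAp (a : Fin k → ℕ) (n : ℕ) : Prop :=
  ∀ j, IsMinGen f j n → ¬ ∃ b : Fin k → ℕ,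
    ∑ l, (b l : ℤ) * (f l n : ℤ) = ((∑ l, a l * f l n : ℕ) : ℤ) - (f j n : ℤ)

variable (f) in
/-- At `n`, the combination of the generators with coefficients `a` is the element of the Apéry
set with exactly `i - 1` smaller elements, expressed by finitely many comparisons. -/
def CombIsNth (i : ℕ) (a : Fin k → Fin i) (n : ℕ) : Prop :=
  CombInAp f (fun j => a j) n ∧ ∃ T : Finset (Fin k → Fin i), T.card = i - 1 ∧
    (∀ b ∈ T, CombInAp f (fun j => b j) n ∧
      ∑ j, (b j : ℕ) * f j n < ∑ j, (a j : ℕ) * f j n) ∧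
    (∀ b ∈ T, ∀ c ∈ T, ∑ j, (b j : ℕ) * f j n = ∑ j, (c j : ℕ) * f j n → b = c) ∧
    ∀ c : Fin k → Fin i, CombInAp f (fun j => c j) n →
      ∑ j, (c j : ℕ) * f j n < ∑ j, (a j : ℕ) * f j n →
        ∃ b ∈ T, ∑ j, (b j : ℕ) * f j n = ∑ j, (c j : ℕ) * f j n

theorem combIsNth_iff (h : SG k f n ≠ ⊥) {i : ℕ} (hi : 1 ≤ i) (a : Fin k → Fin i) :
    CombIsNth f i a n ↔ ∑ j, (a j : ℕ) * f j n ∈ Ap k f n ∧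
      {w ∈ Ap k f n | w < ∑ j, (a j : ℕ) * f j n}.ncard = i - 1 := by
  rw [ncard_lt_eq_iff_exists_finset (Ap k f n)
    (fun a : Fin k → Fin i => ∑ j, (a j : ℕ) * f j n) (i - 1) _
    fun z hz hz' => exists_coeff_lt_of_mem_Ap hz (by omega)]
  simp only [mem_Ap_iff h]
  rfl

variable {p : Fin k → ℤ[X]}

theorem isSemilinearSet_comb_le (hp : ∀ j (n : ℕ), (f j n : ℤ) = (p j).eval (n : ℤ))
    (a b : Fin k → ℕ) :
    IsSemilinearSet {n | ∑ j, a j * f j n ≤ ∑ j, b j * f j n} := by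
  convert isSemilinearSet_eval_le_eval (∑ j, C (a j : ℤ) * p j) (∑ j, C (b j : ℤ) * p j) using 1
  ext n
  simp only [Set.mem_ofPred_eq, eval_finsetSum, eval_mul, eval_C, ← hp]
  exact_mod_cast Iff.rfl

theorem isSemilinearSet_comb_lt (hp : ∀ j (n : ℕ), (f j n : ℤ) = (p j).eval (n : ℤ))
    (a b : Fin k → ℕ) :
    IsSemilinearSet {n | ∑ j, a j * f j n < ∑ j, b j * f j n} := by
  simpa only [not_le] using (isSemilinearSet_comb_le hp b a).not

theorem isSemilinearSet_comb_eq (hp : ∀ j (n : ℕ), (f j n : ℤ) = (p j).eval (n : ℤ))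
    (a b : Fin k → ℕ) :
    IsSemilinearSet {n | ∑ j, a j * f j n = ∑ j, b j * f j n} := by
  simpa only [le_antisymm_iff] using
    (isSemilinearSet_comb_le hp a b).and (isSemilinearSet_comb_le hp b a)

theorem isSemilinearSet_isMinGen (hp : ∀ j (n : ℕ), (f j n : ℤ) = (p j).eval (n : ℤ))
    (j : Fin k) : IsSemilinearSet {n | IsMinGen f j n} := by
  have hpos (l : Fin k) : IsSemilinearSet {n | 0 < f l n} := by
    simpa [Pi.single_apply] using isSemilinearSet_comb_lt hp 0 (Pi.single l 1)
  have hle (l : Fin k) : IsSemilinearSet {n | f j n ≤ f l n} := by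
    simpa [Pi.single_apply] using isSemilinearSet_comb_le hp (Pi.single j 1) (Pi.single l 1)
  exact (hpos j).and (.forall_finite fun l => (hpos l).imp (hle l))

theorem isSemilinearSet_combInAp (hp : ∀ j (n : ℕ), (f j n : ℤ) = (p j).eval (n : ℤ))
    (a : Fin k → ℕ) : IsSemilinearSet {n | CombInAp f a n} := by
  refine .forall_finite fun j => (isSemilinearSet_isMinGen hp j).imp (.not ?_)
  convert isSemilinearSet_exists_sum_mul_eval_eq p (fun j n => by rw [← hp]; positivity)
    (∑ l, C (a l : ℤ) * p l - p j) using 1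
  ext n
  simp [eval_finsetSum, ← hp]

theorem isSemilinearSet_combIsNth (hp : ∀ j (n : ℕ), (f j n : ℤ) = (p j).eval (n : ℤ))
    (i : ℕ) (a : Fin k → Fin i) : IsSemilinearSet {n | CombIsNth f i a n} := by
  have hAp (b : Fin k → Fin i) := isSemilinearSet_combInAp hp (fun j => b j)
  have hlt (b c : Fin k → Fin i) := isSemilinearSet_comb_lt hp (fun j => b j) (fun j => c j)
  have heq (b c : Fin k → Fin i) := isSemilinearSet_comb_eq hp (fun j => b j) (fun j => c j)
  refine (hAp a).and (.exists_finite fun T => (IsSemilinearSet.const _).and (.and ?_ (.and ?_ ?_)))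
  · exact .forall_finite fun b => (IsSemilinearSet.const _).imp ((hAp b).and (hlt b a))
  · exact .forall_finite fun b => (IsSemilinearSet.const _).imp <| .forall_finite fun c =>
      (IsSemilinearSet.const _).imp ((heq b c).imp (.const _))
  · exact .forall_finite fun c => (hAp c).imp <| (hlt c a).imp <| .exists_finite fun b =>
      (IsSemilinearSet.const _).and (heq b c)

end Semigroup

theorem isEQP_sum_mul_of_evPeriodic {k : ℕ} {f : Fin k → ℕ → ℕ} {p : Fin k → ℤ[X]}
    (hp : ∀ j (n : ℕ), (f j n : ℤ) = (p j).eval (n : ℤ)) (a : ℕ → Fin k → ℕ) {N q : ℕ}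
    (hq : 1 ≤ q) (ha : ∀ n, N ≤ n → a (n + q) = a n) :
    IsEQP fun n => ((∑ j, a n j * f j n : ℕ) : ℤ) := by
  refine ⟨∑ j, (p j).natDegree, fun s n => ∑ j, (a n j : ℚ) * ((p j).coeff s : ℚ),
    fun s _ => ⟨N, q, hq, fun n hn => by simp only [ha n hn]⟩, fun n => ?_⟩
  simp_rw [Finset.sum_mul]
  rw [Finset.sum_comm]
  push_cast
  refine Finset.sum_congr rfl fun j _ => ?_
  have h1 : (f j n : ℚ) = ((p j).eval (n : ℤ) : ℤ) := by
    rw [← hp]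
    simp
  have h2 := Finset.single_le_sum (f := fun j => (p j).natDegree) (fun _ _ => Nat.zero_le _)
    (Finset.mem_univ j)
  rw [h1, eval_eq_sum_range' (Nat.lt_succ_of_le h2)]
  push_cast
  rw [Finset.mul_sum]
  exact Finset.sum_congr rfl fun s _ => by ring

theorem stmt9 (k : ℕ) (hk : 1 ≤ k) (f : Fin k → ℕ → ℕ)
    (hf : ∀ i, ∃ p : Polynomial ℤ, ∀ n : ℕ, (f i n : ℤ) = p.eval (n : ℤ))
    (i : ℕ) (hi : 1 ≤ i) :
    ∃ g : ℕ → ℤ, IsEQP g ∧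
      ∀ n : ℕ, ((SG k f n : Set ℕ)ᶜ).Finite → SG k f n ≠ ⊥ →
        i ≤ (Ap k f n).ncard →
        ∃ x : ℕ, x ∈ Ap k f n ∧ {y ∈ Ap k f n | y < x}.ncard = i - 1 ∧
          g n = (x : ℤ) := by
  choose p hp using hf
  have : Nonempty (Fin k → Fin i) := ⟨fun _ => ⟨0, hi⟩⟩
  obtain ⟨N, q, hq, hper⟩ := exists_common_period _ (isSemilinearSet_combIsNth hp i)
  let a (n : ℕ) : Fin k → Fin i := Classical.epsilon fun a => CombIsNth f i a n
  refine ⟨_, isEQP_sum_mul_of_evPeriodic hp (fun n j => a n j) (N := N) hq ?_, ?_⟩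
  · intro n hn
    simp only [a, hper n hn]
  · intro n _ hne hcard
    obtain ⟨x, hx, hxi⟩ := exists_mem_ncard_lt_eq (show i - 1 < (Ap k f n).ncard by omega)
    obtain ⟨b, rfl⟩ := exists_coeff_lt_of_mem_Ap hx (i := i) (by omega)
    have hspec : CombIsNth f i (a n) n :=
      Classical.epsilon_spec (p := fun a => CombIsNth f i a n)
        ⟨b, (combIsNth_iff hne hi b).2 ⟨hx, hxi⟩⟩
    obtain ⟨h1, h2⟩ := (combIsNth_iff hne hi _).1 hspec
    exact ⟨_, h1, h2, rfl⟩
end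

section
/- Let f_1, …, f_k : ℕ → ℕ and a : ℕ → ℕ be functions given by polynomials with integer coefficients, and for each n let S_n ⊆ ℕ be the additive submonoid generated by f_1(n), …, f_k(n). Then the function sending n to the cardinality of the length set L_{S_n}(a(n)) is eventually quasi-polynomial (where L_{S_n}(a(n)) is taken to be empty if a(n) ∉ S_n). -/
/-- The length set of `m` in `SG k f n`: all sums `z 0 + … + z (k-1)` over
factorizations `Σ_i z i · f i n = m`. -/
def LSet (k : ℕ) (f : Fin k → ℕ → ℕ) (n m : ℕ) : Set ℕ :=
  {ℓ : ℕ | ∃ z : Fin k → ℕ, (∑ i, z i * f i n) = m ∧ (∑ i, z i) = ℓ}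

/-- The delta set of `m` in `SG k f n`: differences of consecutive elements of
the length set of `m`. -/
def DeltaSetOf (k : ℕ) (f : Fin k → ℕ → ℕ) (n m : ℕ) : Set ℕ :=
  {δ : ℕ | ∃ ℓ ℓ' : ℕ, ℓ ∈ LSet k f n m ∧ ℓ' ∈ LSet k f n m ∧ ℓ < ℓ' ∧
    δ = ℓ' - ℓ ∧ ∀ t ∈ LSet k f n m, ¬ (ℓ < t ∧ t < ℓ')}

open Polynomial in
/-- Working form of eventual quasi-polynomiality: one polynomial per argument, eventually periodic
in that argument. -/
def EvQuasiPoly (g : ℕ → ℚ) : Prop :=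
  ∃ p N : ℕ, 1 ≤ p ∧ ∃ P : ℕ → ℚ[X], (∀ n, N ≤ n → P (n + p) = P n) ∧
    ∀ n, N ≤ n → g n = (P n).eval (n : ℚ)

theorem eventually_periodic_mul {α : Type*} {P : ℕ → α} {p N : ℕ}
    (h : ∀ n, N ≤ n → P (n + p) = P n) (m n : ℕ) (hn : N ≤ n) : P (n + m * p) = P n := by
  induction m with
  | zero => simp
  | succ m ih => rw [add_mul, one_mul, ← add_assoc, h _ (by omega), ih]

namespace EvQuasiPoly

open Polynomial

theorem congr_of_le {g h : ℕ → ℚ} (hg : EvQuasiPoly g) (N : ℕ) (hN : ∀ n, N ≤ n → h n = g n) :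
    EvQuasiPoly h := by
  obtain ⟨p, N', hp, P, hP, hgP⟩ := hg
  refine ⟨p, max N N', hp, P, fun n hn => hP n (by omega), fun n hn => ?_⟩
  rw [hN n (by omega), hgP n (by omega)]

theorem const (c : ℚ) : EvQuasiPoly fun _ => c :=
  ⟨1, 0, le_rfl, fun _ => C c, by simp, by simp⟩

theorem add {g h : ℕ → ℚ} (hg : EvQuasiPoly g) (hh : EvQuasiPoly h) :
    EvQuasiPoly fun n => g n + h n := by
  obtain ⟨p, N, hp, P, hP, hgP⟩ := hg
  obtain ⟨q, M, hq, Q, hQ, hhQ⟩ := hh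
  refine ⟨p * q, max N M, Nat.mul_pos hp hq, fun n => P n + Q n, fun n hn => ?_, fun n hn => ?_⟩
  · simp only
    rw [eventually_periodic_mul hQ p n (by omega), mul_comm p q,
      eventually_periodic_mul hP q n (by omega)]
  · simp only [eval_add]
    rw [hgP n (by omega), hhQ n (by omega)]

theorem neg {g : ℕ → ℚ} (hg : EvQuasiPoly g) : EvQuasiPoly fun n => - g n := by
  obtain ⟨p, N, hp, P, hP, hgP⟩ := hg
  refine ⟨p, N, hp, fun n => - P n, fun n hn => ?_, fun n hn => ?_⟩
  · simp only [hP n hn]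
  · simp only [hgP n hn, eval_neg]

theorem sub {g h : ℕ → ℚ} (hg : EvQuasiPoly g) (hh : EvQuasiPoly h) :
    EvQuasiPoly fun n => g n - h n := by
  simpa only [sub_eq_add_neg] using hg.add hh.neg

theorem shift_right {g : ℕ → ℚ} (hg : EvQuasiPoly g) (c : ℕ) : EvQuasiPoly fun n => g (n - c) := by
  obtain ⟨p, N, hp, P, hP, hgP⟩ := hg
  refine ⟨p, N + c, hp, fun n => (P (n - c)).comp (X - C (c : ℚ)), fun n hn => ?_, fun n hn => ?_⟩
  · simp only
    rw [show n + p - c = n - c + p by omega, hP _ (by omega)]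
  · simp only [eval_comp, eval_sub, eval_X, eval_C]
    rw [hgP _ (by omega), Nat.cast_sub (by omega)]

theorem shift_left {g : ℕ → ℚ} (hg : EvQuasiPoly g) (c : ℕ) : EvQuasiPoly fun n => g (n + c) := by
  obtain ⟨p, N, hp, P, hP, hgP⟩ := hg
  refine ⟨p, N, hp, fun n => (P (n + c)).comp (X + C (c : ℚ)), fun n hn => ?_, fun n hn => ?_⟩
  · simp only
    rw [show n + p + c = n + c + p by omega, hP _ (by omega)]
  · simp only [eval_comp, eval_add, eval_X, eval_C]
    rw [hgP _ (by omega), Nat.cast_add]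

theorem exists_antidifference (q : ℕ) (hq : 1 ≤ q) (P : ℚ[X]) :
    ∃ Q : ℚ[X], ∀ x : ℚ, Q.eval (x + q) - Q.eval x = P.eval x := by
  have hq' : (q : ℚ) ≠ 0 := by positivity
  induction P using Polynomial.induction_on' with
  | add P R hP hR =>
    obtain ⟨Q, hQ⟩ := hP
    obtain ⟨S, hS⟩ := hR
    refine ⟨Q + S, fun x => ?_⟩
    rw [eval_add, eval_add, eval_add, ← hQ, ← hS]
    ring
  | monomial k a =>
    refine ⟨C (a * q ^ k / (k + 1)) * (Polynomial.bernoulli (k + 1)).comp (C (q : ℚ)⁻¹ * X),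
      fun x => ?_⟩
    have hx : (q : ℚ)⁻¹ * (x + q) = 1 + (q : ℚ)⁻¹ * x := by field_simp; ring
    simp only [eval_mul, eval_C, eval_comp, eval_X, hx, eval_monomial,
      Polynomial.bernoulli_eval_one_add, Nat.add_sub_cancel, mul_pow, inv_pow, Nat.cast_add,
      Nat.cast_one]
    have hk : (k : ℚ) + 1 ≠ 0 := by positivity
    field_simp
    ring

theorem of_difference {g h : ℕ → ℚ} (hh : EvQuasiPoly h) (w : ℕ) (hw : 1 ≤ w)
    (hg : ∀ n, g (n + w) = g n + h n) : EvQuasiPoly g := by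
  have hsum : ∀ m n, g (n + m * w) = g n + ∑ i ∈ Finset.range m, h (n + i * w) := by
    intro m n
    induction m with
    | zero => simp
    | succ m ih => rw [Finset.sum_range_succ, add_mul, one_mul, ← add_assoc, hg, ih, add_assoc]
  obtain ⟨p, N, hp, P, hP, hhP⟩ := hh
  choose Q hQ using exists_antidifference (p * w) (Nat.mul_pos hp hw)
  let R : ℕ → ℚ[X] := fun n =>
    ∑ i ∈ Finset.range p, (P (n + i * w)).comp (X + C ((i * w : ℕ) : ℚ))
  have hR : ∀ n, N ≤ n → R (n + p * w) = R n := by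
    intro n hn
    refine Finset.sum_congr rfl fun i _ => ?_
    rw [show n + p * w + i * w = n + i * w + w * p by ring,
      eventually_periodic_mul hP w _ (by omega)]
  have hstep : ∀ n, N ≤ n → g (n + p * w) = g n + (R n).eval (n : ℚ) := by
    intro n hn
    rw [hsum, eval_finsetSum]
    congr 1
    refine Finset.sum_congr rfl fun i _ => ?_
    rw [hhP _ (by omega)]
    simp
  refine ⟨p * w, N, Nat.mul_pos hp hw, fun n => Q (R n) + C (g n - (Q (R n)).eval (n : ℚ)),
    fun n hn => ?_, fun n _ => by simp⟩
  have := hQ (R n) n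
  simp only [hR n hn]
  rw [hstep n hn, Nat.cast_add, ← this]
  congr 2
  ring

end EvQuasiPoly

/-- The graded pieces `{x ∈ s | d x = n}` are finite and their sizes are eventually quasi-polynomial
in `n`. -/
def HasEvQuasiPolyCount {α : Type*} (d : α → ℕ) (s : Set α) : Prop :=
  (∀ n, {x | x ∈ s ∧ d x = n}.Finite) ∧ EvQuasiPoly fun n => ({x | x ∈ s ∧ d x = n}.ncard : ℚ)

namespace HasEvQuasiPolyCount

variable {α β : Type*} {d : α → ℕ} {s t : Set α}

theorem empty : HasEvQuasiPolyCount d ∅ := by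
  refine ⟨fun n => by simp, ?_⟩
  simpa using EvQuasiPoly.const 0

theorem union_of_inter (hs : HasEvQuasiPolyCount d s) (ht : HasEvQuasiPolyCount d t)
    (hst : HasEvQuasiPolyCount d (s ∩ t)) : HasEvQuasiPolyCount d (s ∪ t) := by
  have hunion : ∀ n, {x | x ∈ s ∪ t ∧ d x = n} = {x | x ∈ s ∧ d x = n} ∪ {x | x ∈ t ∧ d x = n} := by
    intro n; ext x; simp only [Set.mem_union, Set.mem_ofPred_eq]; tauto
  have hinter : ∀ n, {x | x ∈ s ∩ t ∧ d x = n} =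
      {x | x ∈ s ∧ d x = n} ∩ {x | x ∈ t ∧ d x = n} := by
    intro n; ext x; simp only [Set.mem_inter_iff, Set.mem_ofPred_eq]; tauto
  refine ⟨fun n => hunion n ▸ (hs.1 n).union (ht.1 n), ?_⟩
  refine ((hs.2.add ht.2).sub hst.2).congr_of_le 0 fun n _ => ?_
  have h := Set.ncard_union_add_ncard_inter _ _ (hs.1 n) (ht.1 n)
  rw [← hunion, ← hinter] at h
  rw [eq_sub_iff_add_eq]
  exact_mod_cast h

theorem sdiff (hs : HasEvQuasiPolyCount d s) (ht : HasEvQuasiPolyCount d t) (hst : s ⊆ t) :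
    HasEvQuasiPolyCount d (t \ s) := by
  have hdiff : ∀ n, {x | x ∈ t \ s ∧ d x = n} = {x | x ∈ t ∧ d x = n} \ {x | x ∈ s ∧ d x = n} := by
    intro n; ext x; simp only [Set.mem_sdiff, Set.mem_ofPred_eq]; tauto
  refine ⟨fun n => hdiff n ▸ (ht.1 n).subset Set.sdiff_subset, ?_⟩
  refine (ht.2.sub hs.2).congr_of_le 0 fun n _ => ?_
  have h := Set.ncard_sdiff_add_ncard_of_subset
    (s := {x | x ∈ s ∧ d x = n}) (t := {x | x ∈ t ∧ d x = n}) (fun x hx => ⟨hst hx.1, hx.2⟩) (ht.1 n)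
  rw [← hdiff] at h
  rw [eq_sub_iff_add_eq]
  exact_mod_cast h

theorem image {e : β → ℕ} {c : ℕ} (hs : HasEvQuasiPolyCount d s) (φ : α → β) (hφ : Set.InjOn φ s)
    (hd : ∀ x ∈ s, e (φ x) = c + d x) : HasEvQuasiPolyCount e (φ '' s) := by
  have himage : ∀ n, c ≤ n → {y | y ∈ φ '' s ∧ e y = n} = φ '' {x | x ∈ s ∧ d x = n - c} := by
    intro n hn
    ext y
    constructor
    · rintro ⟨⟨x, hx, rfl⟩, hy⟩
      exact ⟨x, ⟨hx, by have := hd x hx; omega⟩, rfl⟩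
    · rintro ⟨x, ⟨hx, hxn⟩, rfl⟩
      exact ⟨⟨x, hx, rfl⟩, by have := hd x hx; omega⟩
  refine ⟨fun n => ?_, ?_⟩
  · by_cases hn : c ≤ n
    · exact himage n hn ▸ (hs.1 _).image φ
    · convert Set.finite_empty
      ext y
      simp only [Set.mem_ofPred_eq, Set.mem_empty_iff_false, iff_false, not_and]
      rintro ⟨x, hx, rfl⟩ hy
      have := hd x hx
      omega
  · refine (hs.2.shift_right c).congr_of_le c fun n hn => ?_
    rw [himage n hn, (hφ.mono fun x hx => hx.1).ncard_image]

/-- Inclusion–exclusion: finite unions of members of an intersection-closed class of sets with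
eventually quasi-polynomial counts have eventually quasi-polynomial counts. -/
theorem list_union {𝒞 : Set (Set α)} (hinter : ∀ s ∈ 𝒞, ∀ t ∈ 𝒞, s ∩ t ∈ 𝒞)
    (hcount : ∀ s ∈ 𝒞, HasEvQuasiPolyCount d s) (l : List (Set α)) (hl : ∀ s ∈ l, s ∈ 𝒞) :
    HasEvQuasiPolyCount d {x | ∃ s ∈ l, x ∈ s} := by
  induction hlen : l.length generalizing l with
  | zero => simpa [List.length_eq_zero_iff.mp hlen] using empty
  | succ k ih =>
    obtain ⟨s, l, rfl⟩ := List.exists_cons_of_length_eq_add_one hlen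
    have hk : l.length = k := by simpa using hlen
    have hs := hl s (by simp)
    have hl' : ∀ t ∈ l, t ∈ 𝒞 := fun t ht => hl t (by simp [ht])
    have hmeet := ih (l.map (s ∩ ·)) (by
      intro t ht
      obtain ⟨u, hu, rfl⟩ := List.mem_map.mp ht
      exact hinter s hs u (hl' u hu)) (by simpa using hk)
    convert (hcount s hs).union_of_inter (ih l hl' hk) ?_ using 1
    · ext x; simp
    · convert hmeet using 1
      ext x; simp only [List.mem_map, Set.mem_inter_iff, Set.mem_ofPred_eq]; aesop

theorem finite_union {𝒞 : Set (Set α)} (hinter : ∀ s ∈ 𝒞, ∀ t ∈ 𝒞, s ∩ t ∈ 𝒞)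
    (hcount : ∀ s ∈ 𝒞, HasEvQuasiPolyCount d s) {I : Type*} {S : Set I} (hS : S.Finite)
    (X : I → Set α) (hX : ∀ i ∈ S, X i ∈ 𝒞) : HasEvQuasiPolyCount d (⋃ i ∈ S, X i) := by
  convert list_union hinter hcount (hS.toFinset.toList.map X) ?_ using 1
  · ext x; simp
  · simpa using hX

theorem finset_disjoint_union {J : Type*} (S : Finset J) (X : J → Set α)
    (hX : ∀ j ∈ S, HasEvQuasiPolyCount d (X j)) (hdisj : ∀ i j, i ≠ j → Disjoint (X i) (X j)) :
    HasEvQuasiPolyCount d (⋃ j ∈ S, X j) := by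
  classical
  induction S using Finset.induction_on with
  | empty => simpa using empty
  | insert i S hi ih =>
    rw [Finset.set_biUnion_insert]
    refine (hX i (by simp)).union_of_inter (ih fun j hj => hX j (by simp [hj])) ?_
    have : Disjoint (X i) (⋃ j ∈ S, X j) := by
      simp only [Set.disjoint_iUnion_right]
      exact fun j hj => hdisj i j (by rintro rfl; exact hi hj)
    rw [this.inter_eq]
    exact empty

end HasEvQuasiPolyCount

/-- The weighted degree of a vector of natural numbers. -/
def weightedDegree {r : ℕ} (w : Fin r → ℕ) (x : Fin r → ℕ) : ℕ := ∑ i, w i * x i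

theorem weightedDegree_add {r : ℕ} (w x y : Fin r → ℕ) :
    weightedDegree w (x + y) = weightedDegree w x + weightedDegree w y := by
  simp [weightedDegree, mul_add, Finset.sum_add_distrib]

theorem finite_setOf_weightedDegree_eq {r : ℕ} (w : Fin r → ℕ) (hw : ∀ i, 1 ≤ w i) (n : ℕ) :
    {x | weightedDegree w x = n}.Finite := by
  refine (Set.finite_Iic (fun _ : Fin r => n)).subset fun x hx i => ?_
  have hx' : ∑ i, w i * x i = n := hx
  calc x i ≤ w i * x i := Nat.le_mul_of_pos_left _ (hw i)
    _ ≤ ∑ i, w i * x i := Finset.single_le_sum (f := fun i => w i * x i) (by simp) (by simp)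
    _ = n := hx'

theorem ncard_weightedDegree_succ {r : ℕ} (w : Fin (r + 1) → ℕ) (hw : ∀ i, 1 ≤ w i) (n : ℕ) :
    {x | weightedDegree w x = n + w 0}.ncard =
      {x | weightedDegree w x = n}.ncard +
        {x | weightedDegree (fun i => w i.succ) x = n + w 0}.ncard := by
  have hsplit : {x | weightedDegree w x = n + w 0} =
      (fun x => x + Pi.single 0 1) '' {x | weightedDegree w x = n} ∪
        Fin.cons 0 '' {x | weightedDegree (fun i => w i.succ) x = n + w 0} := by
    ext x
    simp only [Set.mem_ofPred_eq, Set.mem_union, Set.mem_image]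
    have hsingle : weightedDegree w (Pi.single 0 1) = w 0 := by
      simp [weightedDegree, Fin.sum_univ_succ]
    constructor
    · intro hx
      by_cases h0 : x 0 = 0
      · refine Or.inr ⟨Fin.tail x, ?_, by rw [← h0]; exact Fin.cons_self_tail x⟩
        simpa [weightedDegree, Fin.sum_univ_succ, h0, Fin.tail] using hx
      · refine Or.inl ⟨x - Pi.single 0 1, ?_, ?_⟩
        · have hle : Pi.single 0 1 ≤ x := by
            intro i
            refine Fin.cases ?_ (fun j => ?_) i
            · simpa using Nat.one_le_iff_ne_zero.mpr h0
            · simp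
          have := weightedDegree_add w (x - Pi.single 0 1) (Pi.single 0 1)
          rw [tsub_add_cancel_of_le hle, hsingle, hx] at this
          omega
        · funext i
          refine Fin.cases ?_ (fun j => ?_) i
          · simp; omega
          · simp
    · rintro (⟨y, hy, rfl⟩ | ⟨y, hy, rfl⟩)
      · rw [weightedDegree_add, hy, hsingle]
      · simpa [weightedDegree, Fin.sum_univ_succ] using hy
  rw [hsplit, Set.ncard_union_eq ?_ ((finite_setOf_weightedDegree_eq w hw n).image _)
    ((finite_setOf_weightedDegree_eq _ (fun i => hw i.succ) _).image _),
    Set.ncard_image_of_injective _ (add_left_injective _),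
    Set.ncard_image_of_injective _ (Fin.cons_right_injective _)]
  · rw [Set.disjoint_left]
    rintro x ⟨y, -, rfl⟩ ⟨z, -, hz⟩
    have := congrFun hz 0
    simp at this

theorem hasEvQuasiPolyCount_univ {r : ℕ} (w : Fin r → ℕ) (hw : ∀ i, 1 ≤ w i) :
    HasEvQuasiPolyCount (weightedDegree w) Set.univ := by
  refine ⟨fun n => by simpa using finite_setOf_weightedDegree_eq w hw n, ?_⟩
  simp only [Set.mem_univ, true_and]
  induction r with
  | zero =>
    refine (EvQuasiPoly.const 0).congr_of_le 1 fun n hn => ?_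
    have : {x : Fin 0 → ℕ | weightedDegree w x = n} = ∅ := by
      ext x
      simp only [weightedDegree, Finset.univ_eq_empty, Finset.sum_empty, Set.mem_ofPred_eq,
        Set.mem_empty_iff_false, iff_false]
      omega
    simp [this]
  | succ r ih =>
    refine EvQuasiPoly.of_difference ((ih _ fun i => hw i.succ).shift_left (w 0)) (w 0) (hw 0)
      fun n => ?_
    rw [ncard_weightedDegree_succ w hw n]
    push_cast
    rfl

theorem hasEvQuasiPolyCount_of_isUpperSet {r : ℕ} (w : Fin r → ℕ) (hw : ∀ i, 1 ≤ w i)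
    {I : Set (Fin r → ℕ)} (hI : IsUpperSet I) : HasEvQuasiPolyCount (weightedDegree w) I := by
  have hpwo := Set.isPWO_of_wellQuasiOrderedLE I
  have hfin : {m | Minimal (· ∈ I) m}.Finite :=
    (setOfPred_minimal_antichain _).finite_of_partiallyWellOrderedOn
      (hpwo.mono (setOfPred_minimal_subset _))
  have hIeq : I = ⋃ m ∈ {m | Minimal (· ∈ I) m}, Set.Ici m := by
    ext x
    simp only [Set.mem_ofPred_eq, Set.mem_iUnion, Set.mem_Ici, exists_prop]
    constructor
    · intro hx
      obtain ⟨m, hmx, hm⟩ := hpwo.exists_le_minimal hx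
      exact ⟨m, hm, hmx⟩
    · rintro ⟨m, hm, hmx⟩
      exact hI hmx hm.prop
  rw [hIeq]
  refine HasEvQuasiPolyCount.finite_union (𝒞 := Set.range Set.Ici) ?_ ?_ hfin _ (by simp)
  · rintro _ ⟨a, rfl⟩ _ ⟨b, rfl⟩
    exact ⟨a ⊔ b, Set.Ici_inter_Ici.symm⟩
  · rintro _ ⟨a, rfl⟩
    convert (hasEvQuasiPolyCount_univ w hw).image (e := weightedDegree w) (a + ·)
      (add_right_injective a).injOn (fun x _ => weightedDegree_add w a x) using 1
    ext x
    simp only [Set.mem_Ici, Set.image_univ, Set.mem_range]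
    exact ⟨fun h => ⟨x - a, add_tsub_cancel_of_le h⟩, by rintro ⟨y, rfl⟩; exact le_self_add⟩

/-- The image of finitely many copies of `ℕ ^ r` under a degree-compatible map whose fibres are
translation invariant has eventually quasi-polynomial counts. The parameters that are not least in
their fibre for a monomial order form an upper set in every copy. -/
theorem hasEvQuasiPolyCount_range {r q : ℕ} {α : Type*} (w : Fin r → ℕ) (hw : ∀ i, 1 ≤ w i)
    (d : α → ℕ) (d₀ : Fin q → ℕ) (Ψ : Fin q → (Fin r → ℕ) → α)
    (hΨ : ∀ i j x y, Ψ i x = Ψ j y → ∀ z, Ψ i (x + z) = Ψ j (y + z))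
    (hd : ∀ j x, d (Ψ j x) = d₀ j + weightedDegree w x) :
    HasEvQuasiPolyCount d {a | ∃ j x, Ψ j x = a} := by
  let B := Lex (Fin r → ℕ) ×ₗ Fin q
  let mk : Fin q → (Fin r → ℕ) → B := fun j x => toLex (toLex x, j)
  let I : Fin q → Set (Fin r → ℕ) := fun j => {x | ∃ i y, mk i y < mk j x ∧ Ψ i y = Ψ j x}
  have hI : ∀ j, IsUpperSet (I j) := by
    rintro j x x' hxx' ⟨i, y, hlt, hy⟩
    obtain ⟨z, rfl⟩ := exists_add_of_le hxx'
    refine ⟨i, y + z, ?_, hΨ _ _ _ _ hy z⟩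
    rw [Prod.Lex.toLex_lt_toLex] at hlt ⊢
    rcases hlt with hlt | ⟨heq, hlt⟩
    · exact Or.inl (add_lt_add_left hlt (toLex z))
    · exact Or.inr ⟨congrArg (· + toLex z) heq, hlt⟩
  have hinj : ∀ i j x y, x ∉ I i → y ∉ I j → Ψ i x = Ψ j y → mk i x = mk j y := by
    intro i j x y hx hy h
    rcases lt_trichotomy (mk i x) (mk j y) with hlt | heq | hlt
    · exact absurd ⟨i, x, hlt, h⟩ hy
    · exact heq
    · exact absurd ⟨j, y, hlt, h.symm⟩ hx
  have hmk : ∀ i j x y, mk i x = mk j y → i = j ∧ x = y := by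
    intro i j x y h
    have h' := congrArg ofLex h
    simp only [mk, ofLex_toLex, Prod.mk.injEq] at h'
    exact ⟨h'.2, toLex.injective h'.1⟩
  have hrange : {a | ∃ j x, Ψ j x = a} = ⋃ j ∈ (Finset.univ : Finset (Fin q)), Ψ j '' (I j)ᶜ := by
    ext a
    simp only [Set.mem_ofPred_eq, Finset.mem_univ, Set.iUnion_true, Set.mem_iUnion, Set.mem_image,
      Set.mem_compl_iff]
    constructor
    · rintro ⟨j, x, hx⟩
      obtain ⟨b, hb, hmin⟩ := (wellFounded_lt (α := B)).has_min
        {b | Ψ (ofLex b).2 (ofLex (ofLex b).1) = a} ⟨mk j x, hx⟩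
      refine ⟨(ofLex b).2, ofLex (ofLex b).1, ?_, hb⟩
      rintro ⟨i, y, hlt, hy⟩
      exact hmin (mk i y) (hy.trans hb) hlt
    · rintro ⟨j, x, -, hx⟩
      exact ⟨j, x, hx⟩
  rw [hrange]
  refine HasEvQuasiPolyCount.finset_disjoint_union _ _ (fun j _ => ?_) fun i j hij => ?_
  · refine HasEvQuasiPolyCount.image (d := weightedDegree w) (c := d₀ j) ?_ (Ψ j) ?_
      fun x _ => hd j x
    · rw [Set.compl_eq_univ_sdiff]
      exact (hasEvQuasiPolyCount_of_isUpperSet w hw (hI j)).sdiff (hasEvQuasiPolyCount_univ w hw)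
        (Set.subset_univ _)
    · exact fun x hx y hy h => (hmk _ _ _ _ (hinj j j x y hx hy h)).2
  · rw [Set.disjoint_left]
    rintro _ ⟨x, hx, rfl⟩ ⟨y, hy, h⟩
    exact hij (hmk _ _ _ _ (hinj j i y x hy hx h)).1.symm

/-- The set `X ⊆ ℕ ^ σ` is the projection of the solution set in `ℕ ^ (σ ⊕ τ)` of a linear system
over the integers, and the homogeneous system has no nonzero solution of degree zero. -/
def IsSystemProjection {σ : Type} (d : (σ → ℕ) →+ ℕ) (X : Set (σ → ℕ)) : Prop :=
  ∃ (τ : Type) (_ : Finite τ) (E : Type) (_ : AddCommGroup E) (A : (σ ⊕ τ → ℕ) →+ E) (c : E),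
    (∀ v, A v = 0 → d (v ∘ Sum.inl) = 0 → v = 0) ∧ X = {x | ∃ y, A (Sum.elim x y) = c}

namespace IsSystemProjection

variable {σ : Type} {d : (σ → ℕ) →+ ℕ} {X Y : Set (σ → ℕ)}

theorem inter (hX : IsSystemProjection d X) (hY : IsSystemProjection d Y) :
    IsSystemProjection d (X ∩ Y) := by
  obtain ⟨τ, _, E, _, A, c, hA, rfl⟩ := hX
  obtain ⟨τ', _, E', _, A', c', hA', rfl⟩ := hY
  let ρ : (σ ⊕ (τ ⊕ τ') → ℕ) →+ (σ ⊕ τ → ℕ) :=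
    (LinearMap.funLeft ℕ ℕ (Sum.map id Sum.inl)).toAddMonoidHom
  let ρ' : (σ ⊕ (τ ⊕ τ') → ℕ) →+ (σ ⊕ τ' → ℕ) :=
    (LinearMap.funLeft ℕ ℕ (Sum.map id Sum.inr)).toAddMonoidHom
  have hρ : ∀ v s, ρ v s = v (Sum.map id Sum.inl s) := fun _ _ => rfl
  have hρ' : ∀ v s, ρ' v s = v (Sum.map id Sum.inr s) := fun _ _ => rfl
  refine ⟨τ ⊕ τ', inferInstance, E × E', inferInstance, (A.comp ρ).prod (A'.comp ρ'), (c, c'),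
    fun v hv hd => ?_, ?_⟩
  · simp only [AddMonoidHom.prod_apply, AddMonoidHom.comp_apply, Prod.mk_eq_zero] at hv
    have h := hA (ρ v) hv.1 hd
    have h' := hA' (ρ' v) hv.2 hd
    funext s
    rcases s with s | s | s
    · exact congrFun h (Sum.inl s)
    · exact congrFun h (Sum.inr s)
    · exact congrFun h' (Sum.inr s)
  · ext x
    simp only [Set.mem_inter_iff, Set.mem_ofPred_eq, AddMonoidHom.prod_apply,
      AddMonoidHom.comp_apply, Prod.mk.injEq]
    have hl : ∀ y, ρ (Sum.elim x y) = Sum.elim x (y ∘ Sum.inl) := by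
      intro y; funext s; rcases s with s | s <;> simp [hρ]
    have hr : ∀ y, ρ' (Sum.elim x y) = Sum.elim x (y ∘ Sum.inr) := by
      intro y; funext s; rcases s with s | s <;> simp [hρ']
    constructor
    · rintro ⟨⟨y, hy⟩, ⟨y', hy'⟩⟩
      exact ⟨Sum.elim y y', by simpa [hl] using hy, by simpa [hr] using hy'⟩
    · rintro ⟨y, hy, hy'⟩
      exact ⟨⟨_, (hl y) ▸ hy⟩, ⟨_, (hr y) ▸ hy'⟩⟩

theorem hasEvQuasiPolyCount [Finite σ] (hX : IsSystemProjection d X) :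
    HasEvQuasiPolyCount d X := by
  classical
  obtain ⟨τ, _, E, _, A, c, hA, rfl⟩ := hX
  let π : (σ ⊕ τ → ℕ) →+ (σ → ℕ) := (LinearMap.funLeft ℕ ℕ Sum.inl).toAddMonoidHom
  have hπ : ∀ v, π v = v ∘ Sum.inl := fun _ => rfl
  have hpwo := Set.isPWO_of_wellQuasiOrderedLE {v | A v = c}
  have hfin : {m | Minimal (· ∈ {v | A v = c}) m}.Finite :=
    (setOfPred_minimal_antichain _).finite_of_partiallyWellOrderedOn
      (hpwo.mono (setOfPred_minimal_subset _))
  obtain ⟨q, m, -, hm⟩ := hfin.fin_param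
  obtain ⟨S, hS⟩ := AddSubmonoid.fg_of_subtractive (P := AddMonoidHom.mker A) (by
    intro x hx y hxy
    rw [AddMonoidHom.mem_mker] at *
    simpa [hx] using hxy)
  obtain ⟨r, t, -, ht⟩ := (S.erase 0).finite_toSet.fin_param
  have hker : ∀ v, A v = 0 ↔ ∃ a : Fin r → ℕ, v = ∑ i, a i • t i := by
    intro v
    rw [← AddSubmonoid.mem_closure_range_iff_of_fintype, ht, Finset.coe_erase,
      AddSubmonoid.closure_sdiff_singleton_zero, hS, AddMonoidHom.mem_mker]
  have hm_mem : ∀ j, A (m j) = c := by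
    intro j
    have : m j ∈ {m | Minimal (· ∈ {v | A v = c}) m} := hm ▸ Set.mem_range_self j
    exact this.prop
  have ht_pos : ∀ i, 1 ≤ d (π (t i)) := by
    intro i
    have hti : t i ∈ ((S.erase 0 : Finset _) : Set (σ ⊕ τ → ℕ)) := ht ▸ Set.mem_range_self i
    rw [Finset.mem_coe, Finset.mem_erase] at hti
    refine Nat.one_le_iff_ne_zero.mpr fun h => hti.1 (hA _ ?_ h)
    rw [← AddMonoidHom.mem_mker, ← hS]
    exact AddSubmonoid.subset_closure hti.2
  let L : (Fin r → ℕ) →+ (σ ⊕ τ → ℕ) := (Fintype.linearCombination ℕ t).toAddMonoidHom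
  have hL : ∀ a, L a = ∑ i, a i • t i := fun a => rfl
  convert hasEvQuasiPolyCount_range (fun i => d (π (t i))) ht_pos d (fun j => d (π (m j)))
    (fun j a => π (m j + L a)) ?_ ?_ using 1
  · ext x
    simp only [Set.mem_ofPred_eq]
    constructor
    · rintro ⟨y, hy⟩
      obtain ⟨b, hb, hmin⟩ := hpwo.exists_le_minimal hy
      obtain ⟨j, rfl⟩ : b ∈ Set.range m := hm ▸ hmin
      obtain ⟨h, hh⟩ := exists_add_of_le hb
      obtain ⟨a, rfl⟩ := (hker h).mp (by
        have := congrArg A hh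
        rw [map_add, hy, hm_mem] at this
        simpa using this.symm)
      refine ⟨j, a, ?_⟩
      rw [hL, ← hh, hπ]
      rfl
    · rintro ⟨j, a, rfl⟩
      refine ⟨(m j + L a) ∘ Sum.inr, ?_⟩
      rw [hπ, Sum.elim_comp_inl_inr, map_add, hm_mem, (hker (L a)).mpr ⟨a, hL a⟩, add_zero]
  · intro i j x y h z
    simp only [map_add, ← add_assoc] at h ⊢
    rw [h]
  · intro j x
    simp only [map_add, hL, map_sum, map_nsmul, weightedDegree, smul_eq_mul]
    simp only [mul_comm]

end IsSystemProjection

/-- A base-`n` expansion with small coefficients is evaluated by passing bounded carries. -/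
theorem add_sum_mul_pow_eq_iff_exists_carry {n B : ℤ} (hn : 2 ≤ n) {M : ℕ} (e : Fin M → ℤ)
    (g h : ℤ) (he : ∀ m, |e m| ≤ B * n) (hg : |g| ≤ 2 * B) :
    g + ∑ m, e m * n ^ (m : ℕ) = n ^ M * h ↔
      ∃ γ : Fin (M + 1) → ℤ, (∀ i, |γ i| ≤ 2 * B) ∧ γ 0 = g ∧ γ (Fin.last M) = h ∧
        ∀ m, e m + γ m.castSucc = n * γ m.succ := by
  have hn0 : n ≠ 0 := by omega
  induction M generalizing g with
  | zero =>
    simp only [Finset.univ_eq_empty, Finset.sum_empty, add_zero, pow_zero, one_mul]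
    constructor
    · rintro rfl
      exact ⟨fun _ => g, fun _ => hg, rfl, rfl, fun m => m.elim0⟩
    · rintro ⟨γ, -, h0, hl, -⟩
      rw [← h0, ← hl]
      rfl
  | succ M ih =>
    have hexpand : ∑ m, e m * n ^ (m : ℕ) = e 0 + n * ∑ m : Fin M, e m.succ * n ^ (m : ℕ) := by
      rw [Fin.sum_univ_succ, Finset.mul_sum]
      simp only [Fin.val_zero, pow_zero, mul_one, Fin.val_succ, pow_succ]
      congr 1
      exact Finset.sum_congr rfl fun m _ => by ring
    rw [hexpand]
    constructor
    · intro heq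
      obtain ⟨g', hg'⟩ : n ∣ g + e 0 := by
        refine ⟨n ^ M * h - ∑ m : Fin M, e m.succ * n ^ (m : ℕ), ?_⟩
        rw [mul_sub, ← mul_assoc, ← pow_succ', ← heq]
        ring
      have hbound : |g'| ≤ 2 * B := by
        have h1 : |g'| * n ≤ 2 * B + B * n := by
          calc |g'| * n = |g + e 0| := by rw [hg', abs_mul, abs_of_pos (by omega : 0 < n), mul_comm]
            _ ≤ |g| + |e 0| := abs_add_le _ _
            _ ≤ 2 * B + B * n := add_le_add hg (he 0)
        have hB : 0 ≤ B := by have := abs_nonneg g; omega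
        by_contra! hlt
        nlinarith
      obtain ⟨γ, hγ, h0, hl, hrec⟩ := (ih (fun m => e m.succ) g' (fun m => he _) hbound).mp (by
        refine mul_left_cancel₀ hn0 ?_
        rw [mul_add, ← hg', ← mul_assoc, ← pow_succ', ← heq]
        ring)
      refine ⟨Fin.cons g γ, ?_, by simp, by rw [← Fin.succ_last, Fin.cons_succ, hl], ?_⟩
      · exact Fin.cases (by simpa using hg) (by simpa using hγ)
      · refine Fin.cases ?_ fun m => ?_
        · rw [Fin.castSucc_zero, Fin.cons_zero, Fin.cons_succ, h0, ← hg', add_comm]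
        · rw [Fin.castSucc_succ, Fin.cons_succ, Fin.cons_succ, hrec]
    · rintro ⟨γ, hγ, h0, hl, hrec⟩
      have := (ih (fun m => e m.succ) (γ 1) (fun m => he _) (hγ 1)).mpr
        ⟨fun i => γ i.succ, fun i => hγ _, rfl, by simp only [Fin.succ_last, hl], fun m => hrec m.succ⟩
      have h1 := hrec 0
      rw [Fin.castSucc_zero, h0, Fin.succ_zero_eq_one] at h1
      rw [pow_succ', mul_assoc, ← this, mul_add, ← h1]
      ring

theorem sum_mul_pow_injOn {n D : ℕ} :
    Set.InjOn (fun x : Fin D → ℕ => ∑ j, x j * n ^ (j : ℕ)) {x | ∀ j, x j < n} := by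
  intro x hx y hy h
  have h' : finFunctionFinEquiv (fun j => (⟨x j, hx j⟩ : Fin n)) =
      finFunctionFinEquiv (fun j => (⟨y j, hy j⟩ : Fin n)) := by
    ext
    simpa [finFunctionFinEquiv_apply] using h
  funext j
  simpa using congrFun (finFunctionFinEquiv.injective h') j

theorem lt_pow_iff_exists_digits {n D y : ℕ} :
    y < n ^ D ↔ ∃ x : Fin D → ℕ, (∀ j, x j < n) ∧ y = ∑ j, x j * n ^ (j : ℕ) := by
  constructor
  · intro hy
    refine ⟨fun j => finFunctionFinEquiv.symm ⟨y, hy⟩ j, fun j => Fin.is_lt _, ?_⟩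
    rw [← finFunctionFinEquiv_apply, Equiv.apply_symm_apply]
  · rintro ⟨x, hx, rfl⟩
    have := (finFunctionFinEquiv fun j => (⟨x j, hx j⟩ : Fin n)).2
    rwa [finFunctionFinEquiv_apply] at this

section DigitSystem

variable {ε V : Type} [Fintype V] {D M : ℕ}

/-- The pairs consisting of a base `n` and of selected digits of a digit vector `v` which satisfies
the linear equations with coefficients `a` and constants `b` with prescribed carries `γ`. -/
def carrySystem (p : Fin D → V) (a : ε → Fin M → V → ℤ) (b : ε → Fin M → ℤ)
    (γ : ε → Fin (M + 1) → ℤ) : Set (Option (Fin D) → ℕ) :=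
  {x | ∃ v : V → ℕ, (∀ i, v i < x none) ∧ (∀ j, x (some j) = v (p j)) ∧
    ∀ e m, (∑ i, (v i : ℤ) * a e m i + b e m) + γ e m.castSucc = x none * γ e m.succ}

theorem isSystemProjection_carrySystem (p : Fin D → V) (a : ε → Fin M → V → ℤ) (b : ε → Fin M → ℤ)
    (γ : ε → Fin (M + 1) → ℤ) :
    IsSystemProjection (Pi.evalAddMonoidHom (fun _ => ℕ) none) (carrySystem p a b γ) := by
  let A : (Option (Fin D) ⊕ (V ⊕ V) → ℕ) →+ (Fin D → ℤ) × (V → ℤ) × (ε → Fin M → ℤ) :=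
    { toFun := fun v =>
        (fun j => (v (.inl (some j)) : ℤ) - v (.inr (.inl (p j))),
          fun i => (v (.inr (.inl i)) : ℤ) + v (.inr (.inr i)) - v (.inl none),
          fun e m => ∑ i, (v (.inr (.inl i)) : ℤ) * a e m i - v (.inl none) * γ e m.succ)
      map_zero' := by ext <;> simp
      map_add' := by
        intro x y
        ext <;> simp [add_mul, Finset.sum_add_distrib] <;> ring }
  have hA : ∀ v, A v = (fun j => (v (.inl (some j)) : ℤ) - v (.inr (.inl (p j))),
          fun i => (v (.inr (.inl i)) : ℤ) + v (.inr (.inr i)) - v (.inl none),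
          fun e m => ∑ i, (v (.inr (.inl i)) : ℤ) * a e m i - v (.inl none) * γ e m.succ) :=
    fun _ => rfl
  refine ⟨V ⊕ V, inferInstance, _, inferInstance, A,
    (0, fun _ => -1, fun e m => - b e m - γ e m.castSucc), fun v hv hd => ?_, ?_⟩
  · simp only [hA, Prod.mk_eq_zero, funext_iff, Pi.zero_apply] at hv
    obtain ⟨h1, h2, -⟩ := hv
    have h0 : v (.inl none) = 0 := hd
    funext s
    rcases s with (_ | j) | i | i
    · exact h0
    · have := h1 j
      have := h2 (p j)
      simp only [Pi.zero_apply]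
      omega
    · have := h2 i
      simp only [Pi.zero_apply]
      omega
    · have := h2 i
      simp only [Pi.zero_apply]
      omega
  · ext x
    simp only [carrySystem, Set.mem_ofPred_eq, hA, Prod.mk.injEq, funext_iff, Pi.zero_apply,
      Sum.elim_inl, Sum.elim_inr]
    constructor
    · rintro ⟨v, hv, hx, h⟩
      refine ⟨Sum.elim v fun i => x none - 1 - v i, fun j => by simp [hx], fun i => ?_,
        fun e m => ?_⟩
      · have := hv i
        simp only [Sum.elim_inl, Sum.elim_inr]
        omega
      · have := h e m
        simp only [Sum.elim_inl]
        linarith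
    · rintro ⟨y, h1, h2, h3⟩
      refine ⟨fun i => y (.inl i), fun i => ?_, fun j => ?_, fun e m => ?_⟩
      · have := h2 i
        simp only
        omega
      · have := h1 j
        simp only
        omega
      · have := h3 e m
        linarith

theorem evQuasiPoly_ncard_digitSystem [Fintype ε] (p : Fin D → V) (a : ε → Fin M → V → ℤ)
    (b : ε → Fin M → ℤ) :
    EvQuasiPoly fun n : ℕ => ({t : ℕ | ∃ v : V → ℕ, (∀ i, v i < n) ∧
      t = ∑ j, v (p j) * n ^ (j : ℕ) ∧
      ∀ e, ∑ m, (∑ i, (v i : ℤ) * a e m i + b e m) * (n : ℤ) ^ (m : ℕ) = 0}.ncard : ℚ) := by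
  classical
  let B : ℤ := ∑ e, ∑ m, (∑ i, |a e m i| + |b e m|)
  have hB : ∀ e m, ∑ i, |a e m i| + |b e m| ≤ B := by
    intro e m
    have hnn : ∀ e m, 0 ≤ ∑ i, |a e m i| + |b e m| := fun e m => by positivity
    exact (Finset.single_le_sum (f := fun m => ∑ i, |a e m i| + |b e m|) (fun m _ => hnn e m)
      (Finset.mem_univ m)).trans
      (Finset.single_le_sum (f := fun e => ∑ m, (∑ i, |a e m i| + |b e m|))
        (fun e _ => Finset.sum_nonneg fun m _ => hnn e m) (Finset.mem_univ e))
  have hB0 : 0 ≤ B := by positivity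
  let S : Set (ε → Fin (M + 1) → ℤ) :=
    {γ | ∀ e, (∀ i, |γ e i| ≤ 2 * B) ∧ γ e 0 = 0 ∧ γ e (Fin.last M) = 0}
  have hS : S.Finite := by
    refine (Set.finite_Icc (fun (_ : ε) (_ : Fin (M + 1)) => -(2 * B)) fun _ _ => 2 * B).subset ?_
    exact fun γ hγ => ⟨fun e i => (abs_le.mp ((hγ e).1 i)).1, fun e i => (abs_le.mp ((hγ e).1 i)).2⟩
  have hcount := HasEvQuasiPolyCount.finite_union
    (𝒞 := {X | IsSystemProjection (Pi.evalAddMonoidHom (fun _ : Option (Fin D) => ℕ) none) X})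
    (fun _ hs _ ht => hs.inter ht) (fun _ hs => hs.hasEvQuasiPolyCount) hS (carrySystem p a b)
    (fun γ _ => isSystemProjection_carrySystem p a b γ)
  refine hcount.2.congr_of_le 2 fun n hn => ?_
  have hn' : (2 : ℤ) ≤ n := by exact_mod_cast hn
  have hcarry : ∀ v : V → ℕ, (∀ i, v i < n) →
      ((∀ e, ∑ m, (∑ i, (v i : ℤ) * a e m i + b e m) * (n : ℤ) ^ (m : ℕ) = 0) ↔
        ∃ γ ∈ S, ∀ e m, (∑ i, (v i : ℤ) * a e m i + b e m) + γ e m.castSucc = n * γ e m.succ) := by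
    intro v hv
    have hsmall : ∀ e m, |∑ i, (v i : ℤ) * a e m i + b e m| ≤ B * n := by
      intro e m
      calc |∑ i, (v i : ℤ) * a e m i + b e m|
          ≤ ∑ i, |(v i : ℤ) * a e m i| + |b e m| :=
            (abs_add_le _ _).trans (add_le_add_left (Finset.abs_sum_le_sum_abs _ _) _)
        _ ≤ ∑ i, |a e m i| * n + |b e m| * n := by
            refine add_le_add (Finset.sum_le_sum fun i _ => ?_)
              (le_mul_of_one_le_right (abs_nonneg _) (by omega))
            rw [abs_mul, mul_comm, Nat.abs_cast]
            exact mul_le_mul_of_nonneg_left (by exact_mod_cast (hv i).le) (abs_nonneg _)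
        _ = (∑ i, |a e m i| + |b e m|) * n := by rw [add_mul, Finset.sum_mul]
        _ ≤ B * n := mul_le_mul_of_nonneg_right (hB e m) (by omega)
    have hiff := fun e => add_sum_mul_pow_eq_iff_exists_carry hn'
      (fun m => ∑ i, (v i : ℤ) * a e m i + b e m) 0 0 (hsmall e) (by simpa using hB0)
    simp only [zero_add, mul_zero] at hiff
    simp only [hiff]
    constructor
    · intro h
      choose γ hγ h0 hl hrec using h
      exact ⟨γ, fun e => ⟨hγ e, h0 e, hl e⟩, hrec⟩
    · rintro ⟨γ, hγ, hrec⟩ e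
      exact ⟨γ e, (hγ e).1, (hγ e).2.1, (hγ e).2.2, hrec e⟩
  have himage : {t : ℕ | ∃ v : V → ℕ, (∀ i, v i < n) ∧ t = ∑ j, v (p j) * n ^ (j : ℕ) ∧
      ∀ e, ∑ m, (∑ i, (v i : ℤ) * a e m i + b e m) * (n : ℤ) ^ (m : ℕ) = 0} =
      (fun x : Option (Fin D) → ℕ => ∑ j, x (some j) * n ^ (j : ℕ)) ''
        {x | x ∈ ⋃ γ ∈ S, carrySystem p a b γ ∧ Pi.evalAddMonoidHom (fun _ => ℕ) none x = n} := by
    ext t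
    simp only [Set.mem_ofPred_eq, Set.mem_image, Set.mem_iUnion, exists_prop, carrySystem,
      Pi.evalAddMonoidHom_apply]
    constructor
    · rintro ⟨v, hv, rfl, hsum⟩
      obtain ⟨γ, hγ, hrec⟩ := (hcarry v hv).mp hsum
      exact ⟨fun o => o.elim n fun j => v (p j), ⟨⟨γ, hγ, v, hv, fun _ => rfl, hrec⟩, rfl⟩, rfl⟩
    · rintro ⟨x, ⟨⟨γ, hγ, v, hv, hx, hrec⟩, rfl⟩, rfl⟩
      exact ⟨v, hv, by simp only [hx], (hcarry v hv).mpr ⟨γ, hγ, hrec⟩⟩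
  rw [himage, Set.InjOn.ncard_image]
  rintro x ⟨hx, hxn⟩ y ⟨hy, hyn⟩ hxy
  have hdigit : ∀ z ∈ ⋃ γ ∈ S, carrySystem p a b γ, ∀ j, z (some j) < z none := by
    intro z hz j
    simp only [Set.mem_iUnion] at hz
    obtain ⟨γ, -, v, hv, hzv, -⟩ := hz
    rw [hzv]
    exact hv _
  simp only [Pi.evalAddMonoidHom_apply] at hxn hyn
  have := sum_mul_pow_injOn (n := n) (x₁ := fun j => x (some j)) (x₂ := fun j => y (some j))
    (fun j => hxn ▸ hdigit x hx j) (fun j => hyn ▸ hdigit y hy j) hxy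
  funext o
  rcases o with _ | j
  · rw [hxn, hyn]
  · exact congrFun this j

end DigitSystem

theorem evQuasiPoly_ncard_polynomialSystem {ε U : Type} [Fintype ε] [Fintype U] (u₀ : U) (D : ℕ)
    (q : ε → U → Polynomial ℤ) (r : ε → Polynomial ℤ) :
    EvQuasiPoly fun n : ℕ => ({t : ℕ | ∃ y : U → ℕ, (∀ u, y u < n ^ D) ∧ t = y u₀ ∧
      ∀ e, ∑ u, (y u : ℤ) * (q e u).eval (n : ℤ) = (r e).eval (n : ℤ)}.ncard : ℚ) := by
  let M : ℕ := ∑ e, (∑ u, (q e u).natDegree + (r e).natDegree) + D + 1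
  have hM : ∀ e, ∑ u, (q e u).natDegree + (r e).natDegree + D < M := fun e => by
    have := Finset.single_le_sum (f := fun e => ∑ u, (q e u).natDegree + (r e).natDegree)
      (fun _ _ => Nat.zero_le _) (Finset.mem_univ e)
    omega
  have hq : ∀ e u (j : Fin D), (q e u * Polynomial.X ^ (j : ℕ)).natDegree < M := fun e u j => by
    have h1 := Finset.single_le_sum (f := fun u => (q e u).natDegree)
      (fun _ _ => Nat.zero_le _) (Finset.mem_univ u)
    have h2 := Polynomial.natDegree_mul_le (p := q e u) (q := Polynomial.X ^ (j : ℕ))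
    rw [Polynomial.natDegree_X_pow] at h2
    have := hM e
    have := j.2
    omega
  have hr : ∀ e, (r e).natDegree < M := fun e => by
    have := hM e
    omega
  refine (evQuasiPoly_ncard_digitSystem (V := U × Fin D) (M := M) (fun j => (u₀, j))
    (fun e m i => (q e i.1 * Polynomial.X ^ (i.2 : ℕ)).coeff m)
    (fun e m => -(r e).coeff m)).congr_of_le 0 fun n _ => ?_
  have hsum : ∀ (v : U × Fin D → ℕ) (e : ε),
      ∑ m : Fin M, (∑ i, (v i : ℤ) * (q e i.1 * Polynomial.X ^ (i.2 : ℕ)).coeff m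
        + -(r e).coeff m) * (n : ℤ) ^ (m : ℕ) =
      ∑ u, ((∑ j, v (u, j) * n ^ (j : ℕ) : ℕ) : ℤ) * (q e u).eval (n : ℤ)
        - (r e).eval (n : ℤ) := by
    intro v e
    have heval : ∀ P : Polynomial ℤ, P.natDegree < M →
        ∑ m : Fin M, P.coeff m * (n : ℤ) ^ (m : ℕ) = P.eval (n : ℤ) := fun P hP => by
      rw [Fin.sum_univ_eq_sum_range (fun m => P.coeff m * (n : ℤ) ^ m),
        ← Polynomial.eval_eq_sum_range' hP]
    have hterm : ∀ i : U × Fin D,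
        ∑ m : Fin M, (q e i.1 * Polynomial.X ^ (i.2 : ℕ)).coeff m * (n : ℤ) ^ (m : ℕ) =
          (n : ℤ) ^ (i.2 : ℕ) * (q e i.1).eval (n : ℤ) := fun i => by
      rw [heval _ (hq e i.1 i.2), Polynomial.eval_mul, Polynomial.eval_pow, Polynomial.eval_X,
        mul_comm]
    simp only [← sub_eq_add_neg, sub_mul, Finset.sum_sub_distrib, heval _ (hr e), Finset.sum_mul]
    rw [Finset.sum_comm]
    simp only [mul_assoc, ← Finset.mul_sum, hterm, Fintype.sum_prod_type]
    push_cast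
    simp only [Finset.sum_mul, mul_assoc]
  congr 2
  ext t
  simp only [Set.mem_ofPred_eq, hsum, sub_eq_zero]
  constructor
  · rintro ⟨y, hy, rfl, h⟩
    choose x hx hyx using fun u => lt_pow_iff_exists_digits.mp (hy u)
    refine ⟨fun i => x i.1 i.2, fun i => hx _ _, hyx _, fun e => ?_⟩
    simpa only [← hyx] using h e
  · rintro ⟨v, hv, rfl, h⟩
    exact ⟨fun u => ∑ j, v (u, j) * n ^ (j : ℕ),
      fun u => lt_pow_iff_exists_digits.mpr ⟨fun j => v (u, j), fun j => hv _, rfl⟩, rfl, h⟩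

theorem EvQuasiPoly.isEQP {g : ℕ → ℤ} (hg : EvQuasiPoly fun n => (g n : ℚ)) : IsEQP g := by
  obtain ⟨p, N, hp, P, hP, hgP⟩ := hg
  let d : ℕ := ∑ i ∈ Finset.range (N + p), (P i).natDegree
  have hd : ∀ n, (P n).natDegree ≤ d ∨ n < N := by
    intro n
    induction n using Nat.strong_induction_on with
    | _ n ih =>
      rcases lt_or_ge n (N + p) with h | h
      · exact .inl (Finset.single_le_sum (f := fun i => (P i).natDegree)
          (fun _ _ => Nat.zero_le _) (Finset.mem_range.mpr h))
      · have h1 := hP (n - p) (by omega)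
        rw [Nat.sub_add_cancel (by omega)] at h1
        rw [h1]
        exact .inl ((ih (n - p) (by omega)).resolve_right (by omega))
  refine ⟨d, fun i n => if n < N then (if i = 0 then (g n : ℚ) else 0) else (P n).coeff i,
    fun i _ => ⟨N, p, hp, fun n hn => ?_⟩, fun n => ?_⟩
  · simp only [show ¬n + p < N by omega, hn.not_gt, if_false, hP n hn]
  · rcases lt_or_ge n N with h | h
    · simp [h]
    · simp only [h.not_gt, if_false]
      rw [show (g n : ℚ) = _ from hgP n h, Polynomial.eval_eq_sum_range'
        (Nat.lt_succ_of_le ((hd n).resolve_right (by omega)))]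

theorem Polynomial.eventually_eval_natCast_ne_zero {p : Polynomial ℤ} (hp : p ≠ 0) :
    ∀ᶠ n : ℕ in Filter.atTop, p.eval (n : ℤ) ≠ 0 := by
  rw [← Nat.cofinite_eq_atTop, Filter.eventually_cofinite]
  simp only [not_not]
  exact (Polynomial.finite_setOfPred_isRoot hp).preimage Nat.cast_injective.injOn

theorem Polynomial.eventually_eval_natCast_lt_pow (p : Polynomial ℤ) :
    ∀ᶠ n : ℕ in Filter.atTop, p.eval (n : ℤ) < (n : ℤ) ^ (p.natDegree + 1) := by
  let C : ℤ := ∑ i ∈ Finset.range (p.natDegree + 1), |p.coeff i|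
  filter_upwards [Filter.eventually_gt_atTop C.toNat] with n hn
  have hn' : C < n := by omega
  have hn1 : (1 : ℤ) ≤ n := by omega
  calc p.eval (n : ℤ) = ∑ i ∈ Finset.range (p.natDegree + 1), p.coeff i * (n : ℤ) ^ i :=
        Polynomial.eval_eq_sum_range _
    _ ≤ ∑ i ∈ Finset.range (p.natDegree + 1), |p.coeff i| * (n : ℤ) ^ p.natDegree := by
        refine Finset.sum_le_sum fun i hi => ?_
        exact mul_le_mul (le_abs_self _)
          (pow_le_pow_right₀ hn1 (Nat.lt_succ_iff.mp (Finset.mem_range.mp hi)))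
          (by positivity) (abs_nonneg _)
    _ = C * (n : ℤ) ^ p.natDegree := by rw [Finset.sum_mul]
    _ < (n : ℤ) ^ (p.natDegree + 1) := by
        rw [pow_succ']
        exact mul_lt_mul_of_pos_right hn' (by positivity)

theorem ncard_LSet_eq_zero {k : ℕ} {f : Fin k → ℕ → ℕ} {n : ℕ} (m : ℕ) {i : Fin k}
    (hi : f i n = 0) : (LSet k f n m).ncard = 0 := by
  rcases (LSet k f n m).eq_empty_or_nonempty with h | ⟨_, z, hz, -⟩
  · rw [h, Set.ncard_empty]
  · refine Set.Infinite.ncard (Set.infinite_of_forall_exists_gt fun b =>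
      ⟨∑ j, (z + Pi.single i (b + 1) : Fin k → ℕ) j, ⟨z + Pi.single i (b + 1), ?_, rfl⟩, ?_⟩)
    · rw [← hz]
      refine Finset.sum_congr rfl fun j _ => ?_
      rcases eq_or_ne j i with rfl | h
      · simp [hi]
      · simp [h]
    · simp only [Pi.add_apply, Finset.sum_add_distrib, Finset.sum_pi_single', Finset.mem_univ,
        if_true]
      omega

theorem LSet_eq_setOf_lt {k : ℕ} {f : Fin k → ℕ → ℕ} {n m b : ℕ} (hf : ∀ i, f i n ≠ 0)
    (hm : m < b) : LSet k f n m = {t | ∃ y : Option (Fin k) → ℕ, (∀ u, y u < b) ∧ t = y none ∧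
      ∑ i, y (some i) * f i n = m ∧ ∑ i, y (some i) = y none} := by
  ext t
  constructor
  · rintro ⟨z, hz, rfl⟩
    have hle : ∑ i, z i ≤ m := hz ▸ Finset.sum_le_sum fun i _ =>
      Nat.le_mul_of_pos_right _ (Nat.pos_of_ne_zero (hf i))
    refine ⟨fun o => o.elim (∑ i, z i) z, fun u => ?_, rfl, hz, rfl⟩
    rcases u with _ | i
    · exact hle.trans_lt hm
    · exact ((Finset.single_le_sum (fun _ _ => Nat.zero_le _) (Finset.mem_univ i)).trans
        hle).trans_lt hm
  · rintro ⟨y, -, rfl, h1, h2⟩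
    exact ⟨fun i => y (some i), h1, h2⟩

theorem stmt10 (k : ℕ) (hk : 1 ≤ k) (f : Fin k → ℕ → ℕ)
    (hf : ∀ i, ∃ p : Polynomial ℤ, ∀ n : ℕ, (f i n : ℤ) = p.eval (n : ℤ))
    (a : ℕ → ℕ) (ha : ∃ p : Polynomial ℤ, ∀ n : ℕ, (a n : ℤ) = p.eval (n : ℤ)) :
    IsEQP (fun n => ((LSet k f n (a n)).ncard : ℤ)) := by
  choose p hp using hf
  obtain ⟨α, hα⟩ := ha
  apply EvQuasiPoly.isEQP
  simp only [Int.cast_natCast]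
  by_cases h0 : ∃ i, p i = 0
  · obtain ⟨i, hi⟩ := h0
    refine (EvQuasiPoly.const 0).congr_of_le 0 fun n _ => ?_
    rw [ncard_LSet_eq_zero _ (i := i) (by simpa [hi] using hp i n), Nat.cast_zero]
  push Not at h0
  obtain ⟨N, hN⟩ := Filter.eventually_atTop.mp
    ((Filter.eventually_all.mpr fun i =>
      Polynomial.eventually_eval_natCast_ne_zero (h0 i)).and α.eventually_eval_natCast_lt_pow)
  refine (evQuasiPoly_ncard_polynomialSystem (none : Option (Fin k)) (α.natDegree + 1)
    (fun e : Bool => fun o => bif e then o.elim 0 p else o.elim (-1) fun _ => 1)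
    (fun e => bif e then α else 0)).congr_of_le N fun n hn => ?_
  obtain ⟨hne, hlt⟩ := hN n hn
  rw [← hα] at hlt
  rw [LSet_eq_setOf_lt (b := n ^ (α.natDegree + 1))
    (fun i h => hne i (by rw [← hp, h, Nat.cast_zero])) (by exact_mod_cast hlt)]
  congr 2
  ext t
  refine exists_congr fun y => and_congr_right fun _ => and_congr_right fun _ => ?_
  simp only [Bool.forall_bool, Fintype.sum_option, cond_true, cond_false, Option.elim_none,
    Option.elim_some, Polynomial.eval_zero, Polynomial.eval_neg, Polynomial.eval_one, ← hp, ← hα]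
  zify
  constructor
  · rintro ⟨h1, h2⟩
    constructor <;> simp [h1, h2]
  · rintro ⟨h1, h2⟩
    simp only [mul_one, mul_zero, zero_add] at h1 h2
    exact ⟨h2, by linarith⟩
end

section
/- Let f_1, …, f_k : ℕ → ℕ and a : ℕ → ℕ be functions given by polynomials with integer coefficients, and for each n let S_n ⊆ ℕ be the additive submonoid generated by f_1(n), …, f_k(n). Then the function sending n to the cardinality of the delta set Δ_{S_n}(a(n)) is eventually quasi-polynomial (where Δ_{S_n}(a(n)) is taken to be empty if |L_{S_n}(a(n))| ≤ 1). -/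
open Polynomial Filter
open scoped Pointwise

/-- Finite disjoint unions of sets parametrised injectively by affine maps from some `ℕ ^ r`. -/
inductive IsUnambiguous : {M : Type} → [AddCommMonoid M] → Set M → Prop
  | empty {M : Type} [AddCommMonoid M] : IsUnambiguous (∅ : Set M)
  | union {M : Type} [AddCommMonoid M] {s t : Set M} (hs : IsUnambiguous s)
      (ht : IsUnambiguous t) (hst : Disjoint s t) : IsUnambiguous (s ∪ t)
  | range {M : Type} [AddCommMonoid M] {ι : Type} [Fintype ι] (a : M) (φ : (ι → ℕ) →+ M)
      (hφ : Function.Injective fun u => a + φ u) : IsUnambiguous (Set.range fun u => a + φ u)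

namespace IsUnambiguous

variable {M N : Type} [AddCommMonoid M] [AddCommMonoid N]

theorem univ {ι : Type} [Fintype ι] : IsUnambiguous (Set.univ : Set (ι → ℕ)) := by
  have h := range (0 : ι → ℕ) (AddMonoidHom.id _) (fun u v h => by simpa using h)
  convert h using 1
  ext x
  simp

theorem image {s : Set M} (hs : IsUnambiguous s) (b : N) (ψ : M →+ N)
    (hψ : Function.Injective fun u => b + ψ u) : IsUnambiguous ((fun u => b + ψ u) '' s) := by
  induction hs with
  | empty => simpa using empty
  | union _ _ hst ihs iht =>
    rw [Set.image_union]
    exact ihs.union iht ((Set.disjoint_image_iff hψ).2 hst)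
  | range a φ hφ =>
    rw [← Set.range_comp]
    have h : (fun u => b + ψ u) ∘ (fun u => a + φ u) = fun u => (b + ψ a) + (ψ.comp φ) u := by
      ext u
      simp [add_assoc]
    rw [h]
    refine range _ _ ?_
    rw [← h]
    exact hψ.comp hφ

theorem biUnion {τ : Type} (T : Finset τ) (s : τ → Set M) (hs : ∀ i ∈ T, IsUnambiguous (s i))
    (hd : ∀ i ∈ T, ∀ j ∈ T, i ≠ j → Disjoint (s i) (s j)) :
    IsUnambiguous (⋃ i ∈ T, s i) := by
  classical
  induction T using Finset.induction_on with
  | empty => simpa using empty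
  | insert i T hi ih =>
    rw [Finset.set_biUnion_insert]
    refine (hs i (by simp)).union (ih (fun j hj => hs j (by simp [hj])) fun j hj k hk =>
      hd j (by simp [hj]) k (by simp [hk])) ?_
    simp only [Set.disjoint_iUnion_right]
    intro j hj
    exact hd i (by simp) j (by simp [hj]) (by rintro rfl; exact hi hj)

/-- A set is unambiguous if its preimages under finitely many affine charts are, the charts having
disjoint ranges and covering the whole space. -/
theorem of_cover {τ : Type} [Fintype τ] {P : τ → Type} [∀ i, AddCommMonoid (P i)] {C : Set M}
    (b : τ → M) (ψ : ∀ i, P i →+ M) (hψ : ∀ i, Function.Injective fun u => b i + ψ i u)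
    (hcover : ∀ x, ∃ i u, b i + ψ i u = x)
    (hdisj : ∀ i j u v, b i + ψ i u = b j + ψ j v → i = j)
    (h : ∀ i, IsUnambiguous ((fun u => b i + ψ i u) ⁻¹' C)) : IsUnambiguous C := by
  have hC : C = ⋃ i ∈ (Finset.univ : Finset τ),
      (fun u => b i + ψ i u) '' ((fun u => b i + ψ i u) ⁻¹' C) := by
    ext x
    simp only [Finset.mem_univ, Set.iUnion_true, Set.mem_iUnion, Set.mem_image, Set.mem_preimage]
    constructor
    · intro hx
      obtain ⟨i, u, rfl⟩ := hcover x
      exact ⟨i, u, hx, rfl⟩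
    · rintro ⟨i, u, hu, rfl⟩
      exact hu
  rw [hC]
  refine biUnion _ _ (fun i _ => (h i).image _ _ (hψ i)) fun i _ j _ hij => ?_
  rw [Set.disjoint_left]
  rintro _ ⟨u, _, rfl⟩ ⟨v, _, hv⟩
  exact hij (hdisj _ _ _ _ hv.symm)

theorem of_cover_pair {P Q : Type} [AddCommMonoid P] [AddCommMonoid Q] {C : Set M}
    (b c : M) (ψ : P →+ M) (χ : Q →+ M) (hψ : Function.Injective fun u => b + ψ u)
    (hχ : Function.Injective fun u => c + χ u)
    (hcover : ∀ x, (∃ u, b + ψ u = x) ∨ ∃ u, c + χ u = x)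
    (hdisj : ∀ u v, b + ψ u ≠ c + χ v)
    (h₁ : IsUnambiguous ((fun u => b + ψ u) ⁻¹' C))
    (h₂ : IsUnambiguous ((fun u => c + χ u) ⁻¹' C)) : IsUnambiguous C := by
  have hC : C = ((fun u => b + ψ u) '' ((fun u => b + ψ u) ⁻¹' C)) ∪
      ((fun u => c + χ u) '' ((fun u => c + χ u) ⁻¹' C)) := by
    ext x
    constructor
    · intro hx
      rcases hcover x with ⟨u, rfl⟩ | ⟨u, rfl⟩
      · exact Or.inl ⟨u, hx, rfl⟩
      · exact Or.inr ⟨u, hx, rfl⟩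
    · rintro (⟨u, hu, rfl⟩ | ⟨u, hu, rfl⟩) <;> exact hu
  rw [hC]
  refine (h₁.image _ _ hψ).union (h₂.image _ _ hχ) ?_
  rw [Set.disjoint_left]
  rintro _ ⟨u, _, rfl⟩ ⟨v, _, hv⟩
  exact hdisj _ _ hv.symm

/-- The residue charts `w ↦ ρ + m * w` for a vector `m` of positive moduli. -/
theorem of_residues {ι : Type} [Fintype ι] (m : ι → ℕ) (hm : ∀ i, 0 < m i) {C : Set (ι → ℕ)}
    (h : ∀ ρ : ι → ℕ, IsUnambiguous {w : ι → ℕ | (fun i => ρ i + m i * w i) ∈ C}) :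
    IsUnambiguous C := by
  classical
  refine of_cover (τ := ∀ i, Fin (m i)) (P := fun _ => ι → ℕ) (fun ρ i => (ρ i : ℕ))
    (fun _ => AddMonoidHom.mulLeft m) ?_ ?_ ?_ ?_
  · intro ρ u v huv
    ext i
    have := congrFun huv i
    simpa [(hm i).ne'] using this
  · intro x
    refine ⟨fun i => ⟨x i % m i, Nat.mod_lt _ (hm i)⟩, fun i => x i / m i, ?_⟩
    ext i
    simp [Nat.mod_add_div]
  · intro ρ σ u v huv
    ext i
    have := congrArg (· % m i) (congrFun huv i)
    simpa [Nat.add_mul_mod_self_left, Nat.mod_eq_of_lt (ρ i).2, Nat.mod_eq_of_lt (σ i).2] using this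
  · intro ρ
    exact h fun i => ρ i

/-- Splitting according to whether the `i`-th coordinate vanishes. -/
theorem of_zero_or_succ {ι : Type} [Fintype ι] [DecidableEq ι] (i : ι) {C : Set (ι → ℕ)}
    (h₁ : IsUnambiguous {w : {j // j ≠ i} → ℕ |
      (fun j => if h : j ≠ i then w ⟨j, h⟩ else 0) ∈ C})
    (h₂ : IsUnambiguous {w : ι → ℕ | Pi.single i 1 + w ∈ C}) : IsUnambiguous C := by
  let ψ : ({j // j ≠ i} → ℕ) →+ (ι → ℕ) :=
    { toFun := fun w j => if h : j ≠ i then w ⟨j, h⟩ else 0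
      map_zero' := by ext j; simp
      map_add' := fun u v => by ext j; by_cases h : j = i <;> simp [h] }
  refine of_cover_pair (0 : ι → ℕ) (Pi.single i 1) ψ (AddMonoidHom.id _) ?_ ?_ ?_ ?_ ?_ ?_
  · intro u v huv
    ext ⟨j, hj⟩
    have := congrFun huv j
    simpa [ψ, hj] using this
  · intro u v huv
    simpa using huv
  · intro x
    by_cases hx : x i = 0
    · refine Or.inl ⟨fun j => x j, ?_⟩
      ext j
      by_cases h : j = i
      · subst h; simp [ψ, hx]
      · simp [ψ, h]
    · refine Or.inr ⟨x - Pi.single i 1, ?_⟩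
      ext j
      by_cases h : j = i
      · subst h; simp; omega
      · simp [h]
  · intro u v huv
    have := congrFun huv i
    simp [ψ] at this
    omega
  · simp only [zero_add]
    exact h₁
  · exact h₂

/-- Splitting according to whether `x j ≤ x i` or `x i < x j`. -/
theorem of_le_or_lt {ι : Type} [Fintype ι] [DecidableEq ι] {i j : ι} (hij : i ≠ j)
    {C : Set (ι → ℕ)} (h₁ : IsUnambiguous {w : ι → ℕ | w + Pi.single i (w j) ∈ C})
    (h₂ : IsUnambiguous {w : ι → ℕ | Pi.single j 1 + (w + Pi.single j (w i)) ∈ C}) :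
    IsUnambiguous C := by
  let ψ (i j : ι) : (ι → ℕ) →+ (ι → ℕ) :=
    AddMonoidHom.id _ + (AddMonoidHom.single (fun _ => ℕ) i).comp (Pi.evalAddMonoidHom _ j)
  have hψ (i j : ι) (w : ι → ℕ) : ψ i j w = w + Pi.single i (w j) := rfl
  have hinj (b : ι → ℕ) (i j : ι) (hij : i ≠ j) : Function.Injective fun u => b + ψ i j u := by
    intro u v huv
    have huv : u + Pi.single i (u j) = v + Pi.single i (v j) := by
      simpa [hψ] using huv
    have hj : u j = v j := by simpa [hij.symm] using congrFun huv j
    rw [hj] at huv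
    exact add_right_cancel huv
  refine of_cover_pair (0 : ι → ℕ) (Pi.single j 1) (ψ i j) (ψ j i) (hinj _ _ _ hij)
    (hinj _ _ _ hij.symm) ?_ ?_ ?_ ?_
  · intro x
    by_cases hx : x j ≤ x i
    · refine Or.inl ⟨x - Pi.single i (x j), ?_⟩
      ext k
      by_cases h : k = i
      · subst h; simp [hψ, hij.symm]; omega
      · simp [hψ, h]
    · refine Or.inr ⟨x - Pi.single j (x i + 1), ?_⟩
      ext k
      by_cases h : k = j
      · subst h; simp [hψ, hij]; omega
      · simp [hψ, h]
  · intro u v huv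
    have hi := congrFun huv i
    have hj := congrFun huv j
    simp [hψ, hij, hij.symm] at hi hj
    omega
  · simp only [zero_add]
    exact h₁
  · exact h₂

end IsUnambiguous

namespace IsUnambiguous

variable {M : Type} [AddCommMonoid M]

theorem setOf_const {ι : Type} [Fintype ι] (p : Prop) : IsUnambiguous {_w : ι → ℕ | p} := by
  by_cases hp : p
  · simpa [hp] using univ
  · simpa [hp] using empty

theorem halfspace_of_signs (s : ℕ) : ∀ {ι : Type} [Fintype ι] (ε : ι → ℤ) (e : ℤ),
    (∀ i, ε i = -1 ∨ ε i = 0 ∨ ε i = 1) → ∑ i, (ε i).natAbs = s →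
    IsUnambiguous {w : ι → ℕ | 0 ≤ e + ∑ i, ε i * w i} := by
  induction s using Nat.strong_induction_on with
  | _ s ih =>
  intro ι _ ε e hε hs
  classical
  have hdrop (i : ι) (hi : ε i ≠ 0) (e : ℤ) : IsUnambiguous {w : {j // j ≠ i} → ℕ |
      (fun j => if h : j ≠ i then w ⟨j, h⟩ else 0) ∈
        {w : ι → ℕ | 0 ≤ e + ∑ i, ε i * w i}} := by
    have h := ih (∑ j : {j // j ≠ i}, (ε j).natAbs) ?_ (fun j : {j // j ≠ i} => ε j) e
      (fun j => hε j) rfl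
    · convert h using 1
      ext w
      rw [Set.mem_ofPred_eq, Set.mem_ofPred_eq, Set.mem_ofPred_eq,
        Fintype.sum_eq_add_sum_subtype_ne _ i]
      simp only [ne_eq, not_true_eq_false, dite_false, Nat.cast_zero, mul_zero, zero_add]
      rw [Finset.sum_congr rfl fun j _ => by rw [dif_pos j.2]]
    · rw [← hs, Fintype.sum_eq_add_sum_subtype_ne _ i]
      have := Int.natAbs_pos.2 hi
      omega
  have hshift (i : ι) (e : ℤ) : {w : ι → ℕ | Pi.single i 1 + w ∈
      {w : ι → ℕ | 0 ≤ e + ∑ i, ε i * w i}} = {w : ι → ℕ | 0 ≤ (e + ε i) + ∑ i, ε i * w i} := by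
    ext w
    simp [mul_add, Finset.sum_add_distrib, Pi.single_apply, add_assoc]
  have hupdate (i j : ι) (w : ι → ℕ) : ∑ k, (Function.update ε j (ε j + ε i) k) * (w k : ℤ) =
      ∑ k, ε k * (w k : ℤ) + ε i * w j := by
    rw [Fintype.sum_eq_add_sum_subtype_ne _ j, Fintype.sum_eq_add_sum_subtype_ne _ j]
    rw [Finset.sum_congr rfl fun (k : {k // k ≠ j}) _ => by rw [Function.update_of_ne k.2]]
    simp
    ring
  have hsmaller (i j : ι) (hi : ε i ≠ 0) (hij : ε i = - ε j) (e : ℤ) :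
      IsUnambiguous {w : ι → ℕ | 0 ≤ e + (∑ k, ε k * (w k : ℤ) + ε i * w j)} := by
    have h := ih (∑ k, (Function.update ε j (ε j + ε i) k).natAbs) ?_
      (Function.update ε j (ε j + ε i)) e ?_ rfl
    · simpa only [hupdate] using h
    · rw [← hs, Fintype.sum_eq_add_sum_subtype_ne _ j, Fintype.sum_eq_add_sum_subtype_ne _ j]
      rw [Finset.sum_congr rfl fun (k : {k // k ≠ j}) _ => by rw [Function.update_of_ne k.2]]
      simp
      omega
    · intro k
      by_cases hk : k = j
      · subst hk; simp; omega
      · simpa [hk] using hε k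
  by_cases hpos : ∃ i, ε i = 1
  · obtain ⟨i, hi⟩ := hpos
    by_cases hneg : ∃ j, ε j = -1
    · obtain ⟨j, hj⟩ := hneg
      have hij : i ≠ j := by rintro rfl; omega
      refine of_le_or_lt hij ?_ ?_
      · convert hsmaller i j (by omega) (by omega) e using 1
        ext w
        simp [mul_add, Finset.sum_add_distrib, Pi.single_apply]
      · convert hsmaller j i (by omega) (by omega) (e + ε j) using 1
        ext w
        simp [mul_add, Finset.sum_add_distrib, Pi.single_apply, add_assoc]
    · have key (k : ℕ) : ∀ e : ℤ, -e ≤ k →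
          IsUnambiguous {w : ι → ℕ | 0 ≤ e + ∑ i, ε i * w i} := by
        induction k with
        | zero =>
          intro e he
          convert univ (ι := ι) using 1
          refine Set.eq_univ_of_forall fun w => ?_
          have : 0 ≤ ∑ i, ε i * (w i : ℤ) := Finset.sum_nonneg fun j _ => by
            have h1 : ε j ≠ -1 := fun h => hneg ⟨j, h⟩
            have := hε j
            have : 0 ≤ ε j := by omega
            positivity
          simp only [Set.mem_ofPred_eq]
          push_cast at he
          omega
        | succ k ihk =>
          intro e he
          refine of_zero_or_succ i (hdrop i (by omega) e) ?_
          rw [hshift]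
          exact ihk _ (by push_cast at he; omega)
      exact key (-e).toNat e (by omega)
  · by_cases hneg : ∃ j, ε j = -1
    · obtain ⟨i, hi⟩ := hneg
      have key (k : ℕ) : ∀ e : ℤ, e < k →
          IsUnambiguous {w : ι → ℕ | 0 ≤ e + ∑ i, ε i * w i} := by
        induction k with
        | zero =>
          intro e he
          convert empty using 1
          refine Set.eq_empty_of_forall_notMem fun w => ?_
          have : ∑ i, ε i * (w i : ℤ) ≤ 0 := Finset.sum_nonpos fun j _ => by
            have h1 : ε j ≠ 1 := fun h => hpos ⟨j, h⟩
            have := hε j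
            have : ε j ≤ 0 := by omega
            exact mul_nonpos_of_nonpos_of_nonneg this (by positivity)
          simp only [Set.mem_ofPred_eq]
          push_cast at he
          omega
        | succ k ihk =>
          intro e he
          refine of_zero_or_succ i (hdrop i (by omega) e) ?_
          rw [hshift]
          exact ihk _ (by push_cast at he; omega)
      exact key (e + 1).toNat e (by omega)
    · have h0 (i : ι) : ε i = 0 := by
        have := hε i
        have h1 : ε i ≠ -1 := fun h => hneg ⟨i, h⟩
        have h2 : ε i ≠ 1 := fun h => hpos ⟨i, h⟩
        omega
      simpa [h0] using setOf_const _

theorem addMonoidHom_apply_eq_sum {ι : Type} [Fintype ι] [DecidableEq ι] {A : Type*}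
    [AddCommMonoid A] (l : (ι → ℕ) →+ A) (w : ι → ℕ) : l w = ∑ i, w i • l (Pi.single i 1) := by
  conv_lhs => rw [← Finset.univ_sum_single w, map_sum]
  refine Finset.sum_congr rfl fun i _ => ?_
  rw [← map_nsmul]
  congr 1
  ext j
  by_cases h : j = i
  · subst h; simp
  · simp [h]

theorem halfspace {ι : Type} [Fintype ι] (l : (ι → ℕ) →+ ℤ) (e : ℤ) :
    IsUnambiguous {w : ι → ℕ | 0 ≤ e + l w} := by
  classical
  set c : ι → ℤ := fun i => l (Pi.single i 1) with hc
  have hl (w : ι → ℕ) : l w = ∑ i, c i * w i := by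
    rw [addMonoidHom_apply_eq_sum]
    exact Finset.sum_congr rfl fun i _ => by simp [hc, mul_comm]
  set K : ℕ := ∏ i, max (c i).natAbs 1 with hK
  have hKpos : 0 < K := Finset.prod_pos fun i _ => by omega
  have hdvd (i : ι) : max (c i).natAbs 1 ∣ K := Finset.dvd_prod_of_mem _ (Finset.mem_univ i)
  choose m hm using hdvd
  have hmpos (i : ι) : 0 < m i := by
    rcases Nat.eq_zero_or_pos (m i) with h | h
    · have := hm i
      rw [h] at this
      omega
    · exact h
  have hcm (i : ι) : c i * m i = K * Int.sign (c i) := by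
    rcases lt_trichotomy (c i) 0 with h | h | h
    · have h1 : ((max (c i).natAbs 1 : ℕ) : ℤ) = - c i := by omega
      have h2 : (K : ℤ) = ((max (c i).natAbs 1 : ℕ) : ℤ) * m i := by exact_mod_cast hm i
      rw [Int.sign_eq_neg_one_of_neg h, h2, h1]
      ring
    · simp [h]
    · have h1 : ((max (c i).natAbs 1 : ℕ) : ℤ) = c i := by omega
      have h2 : (K : ℤ) = ((max (c i).natAbs 1 : ℕ) : ℤ) * m i := by exact_mod_cast hm i
      rw [Int.sign_eq_one_of_pos h, h2, h1]
      ring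
  refine of_residues m hmpos fun ρ => ?_
  convert halfspace_of_signs _ (fun i => Int.sign (c i)) ((e + l ρ) / K) ?_ rfl using 1
  · ext w
    have h1 : l (fun i => ρ i + m i * w i) = l ρ + K * ∑ i, Int.sign (c i) * (w i : ℤ) := by
      rw [hl, hl, Finset.mul_sum, ← Finset.sum_add_distrib]
      refine Finset.sum_congr rfl fun i _ => ?_
      push_cast
      rw [← mul_assoc, ← hcm]
      ring
    simp only [Set.mem_ofPred_eq, h1]
    have hK' : (0 : ℤ) < K := by exact_mod_cast hKpos
    rw [← add_assoc, ← Int.add_mul_ediv_left _ _ hK'.ne', Int.ediv_nonneg_iff_of_pos hK']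
  · intro i
    rcases lt_trichotomy (c i) 0 with h | h | h
    · exact Or.inl (Int.sign_eq_neg_one_of_neg h)
    · exact Or.inr (Or.inl (by simp [h]))
    · exact Or.inr (Or.inr (Int.sign_eq_one_of_pos h))

theorem congruence {ι : Type} [Fintype ι] (l : (ι → ℕ) →+ ℤ) (e : ℤ) (q : ℕ) (hq : 0 < q)
    (p : Prop → Prop) : IsUnambiguous {w : ι → ℕ | p ((q : ℤ) ∣ e + l w)} := by
  refine of_residues (fun _ => q) (fun _ => hq) fun ρ => ?_
  convert setOf_const (ι := ι) (p ((q : ℤ) ∣ e + l ρ)) using 1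
  ext w
  have h1 : l (fun i => ρ i + q * w i) = l ρ + q * l w := by
    have : (fun i => ρ i + q * w i) = ρ + q • w := by ext i; simp
    rw [this, map_add, map_nsmul]
    simp
  simp only [Set.mem_ofPred_eq, h1]
  rw [← add_assoc, (Int.dvd_add_left (Dvd.intro _ rfl))]

end IsUnambiguous

/-- Sets which split every unambiguous set into two unambiguous sets. -/
def SplitsUnambiguous {M : Type} [AddCommMonoid M] (C : Set M) : Prop :=
  ∀ X : Set M, IsUnambiguous X → IsUnambiguous (X ∩ C) ∧ IsUnambiguous (X \ C)

namespace SplitsUnambiguous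

variable {M : Type} [AddCommMonoid M] {C D : Set M}

theorem of_charts (h : ∀ (ι : Type) [Fintype ι] (a : M) (φ : (ι → ℕ) →+ M),
    IsUnambiguous {u | a + φ u ∈ C} ∧ IsUnambiguous {u | a + φ u ∉ C}) :
    SplitsUnambiguous C := by
  intro X hX
  induction hX with
  | empty => simpa using IsUnambiguous.empty
  | union _ _ hst ihs iht =>
    rw [Set.union_inter_distrib_right, Set.union_sdiff_distrib]
    exact ⟨ihs.1.union iht.1 (hst.mono Set.inter_subset_left Set.inter_subset_left),
      ihs.2.union iht.2 (hst.mono Set.sdiff_subset Set.sdiff_subset)⟩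
  | range a φ hφ =>
    obtain ⟨h₁, h₂⟩ := h _ a φ
    constructor
    · convert h₁.image a φ hφ using 1
      ext x
      constructor
      · rintro ⟨⟨u, rfl⟩, hu⟩
        exact ⟨u, hu, rfl⟩
      · rintro ⟨u, hu, rfl⟩
        exact ⟨⟨u, rfl⟩, hu⟩
    · convert h₂.image a φ hφ using 1
      ext x
      constructor
      · rintro ⟨⟨u, rfl⟩, hu⟩
        exact ⟨u, hu, rfl⟩
      · rintro ⟨u, hu, rfl⟩
        exact ⟨⟨u, rfl⟩, hu⟩

theorem compl (hC : SplitsUnambiguous C) : SplitsUnambiguous Cᶜ := by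
  intro X hX
  rw [← Set.sdiff_eq, Set.sdiff_compl]
  exact (hC X hX).symm

theorem inter (hC : SplitsUnambiguous C) (hD : SplitsUnambiguous D) :
    SplitsUnambiguous (C ∩ D) := by
  intro X hX
  obtain ⟨h₁, h₂⟩ := hC X hX
  obtain ⟨h₃, h₄⟩ := hD _ h₁
  refine ⟨by rwa [← Set.inter_assoc], ?_⟩
  have : X \ (C ∩ D) = (X \ C) ∪ ((X ∩ C) \ D) := by
    ext x
    simp only [Set.mem_sdiff, Set.mem_inter_iff, Set.mem_union]
    tauto
  rw [this]
  refine h₂.union h₄ (Set.disjoint_left.2 ?_)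
  rintro x ⟨_, hx⟩ ⟨⟨_, hx'⟩, _⟩
  exact hx hx'

theorem union (hC : SplitsUnambiguous C) (hD : SplitsUnambiguous D) :
    SplitsUnambiguous (C ∪ D) := by
  have := (hC.compl.inter hD.compl).compl
  rwa [Set.compl_inter, compl_compl, compl_compl] at this

theorem empty : SplitsUnambiguous (∅ : Set M) := fun X hX => by
  simpa using ⟨IsUnambiguous.empty, hX⟩

theorem sUnion {S : Set (Set M)} (hS : S.Finite) (h : ∀ s ∈ S, SplitsUnambiguous s) :
    SplitsUnambiguous (⋃₀ S) := by
  induction S, hS using Set.Finite.induction_on with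
  | empty => simpa using empty
  | insert _ _ ih =>
    rw [Set.sUnion_insert]
    exact (h _ (by simp)).union (ih fun s hs => h s (by simp [hs]))

theorem setOf_forall {τ : Type} [Fintype τ] {p : τ → M → Prop}
    (h : ∀ i, SplitsUnambiguous {x | p i x}) : SplitsUnambiguous {x | ∀ i, p i x} := by
  have : {x | ∀ i, p i x} = (⋃₀ Set.range fun i => {x | p i x}ᶜ)ᶜ := by
    ext x
    simp
  rw [this]
  refine (sUnion (Set.finite_range _) ?_).compl
  rintro _ ⟨i, rfl⟩
  exact (h i).compl

theorem halfspace (l : M →+ ℤ) (e : ℤ) : SplitsUnambiguous {x | 0 ≤ e + l x} := by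
  refine of_charts fun ι _ a φ => ⟨?_, ?_⟩
  · convert IsUnambiguous.halfspace (l.comp φ) (e + l a) using 1
    ext u
    simp [add_assoc]
  · convert IsUnambiguous.halfspace (-(l.comp φ)) (-(e + l a) - 1) using 1
    ext u
    simp
    omega

theorem hyperplane (l : M →+ ℤ) (e : ℤ) : SplitsUnambiguous {x | e + l x = 0} := by
  convert (halfspace l e).inter (halfspace (-l) (-e)) using 1
  ext x
  simp
  omega

theorem congruence (l : M →+ ℤ) (e : ℤ) (q : ℕ) (hq : 0 < q) :
    SplitsUnambiguous {x | (q : ℤ) ∣ e + l x} := by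
  refine of_charts fun ι _ a φ => ⟨?_, ?_⟩
  · convert IsUnambiguous.congruence (l.comp φ) (e + l a) q hq id using 1
    ext u
    simp [add_assoc]
  · convert IsUnambiguous.congruence (l.comp φ) (e + l a) q hq Not using 1
    ext u
    simp [add_assoc]

end SplitsUnambiguous

theorem LinearIndepOn.natCast_rat {ι : Type} {s : Set (ι → ℕ)} (hs : LinearIndepOn ℕ id s) :
    LinearIndepOn ℚ (fun (x : ι → ℕ) i => (x i : ℚ)) s := by
  rw [LinearIndepOn, ← LinearIndependent.iff_fractionRing ℤ ℚ]
  change LinearIndepOn ℤ (fun (x : ι → ℕ) i => (x i : ℚ)) s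
  rw [linearIndepOn_iff'']
  intro t f ht hf heq i hi
  rw [linearIndepOn_iff_linearIndepOn_finset] at hs
  specialize hs t ht
  rw [linearIndepOn_finset_iffₛ] at hs
  specialize hs (fun j => (f j).toNat) (fun j => (-f j).toNat) ?_ i hi
  · ext k
    have hk := congrFun heq k
    simp only [Finset.sum_apply, Pi.smul_apply, id_eq, smul_eq_mul, Pi.zero_apply,
      ← Int.cast_smul_eq_zsmul ℚ] at hk ⊢
    have hsplit : ∑ j ∈ t, (f j) * (j k : ℤ) = 0 := by exact_mod_cast hk
    zify
    rw [← sub_eq_zero, ← Finset.sum_sub_distrib, ← hsplit]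
    refine Finset.sum_congr rfl fun j _ => ?_
    rw [← sub_mul, Int.toNat_sub_toNat_neg]
  · omega

theorem LinearIndepOn.exists_dual {ι : Type} [Fintype ι] {t : Set (ι → ℕ)} (htf : t.Finite)
    (ht : LinearIndepOn ℕ id t) : ∃ q : ℕ, 0 < q ∧ ∃ l : t → ((ι → ℕ) →+ ℤ),
      ∀ b b' : t, l b b' = Finsupp.single b' (q : ℤ) b := by
  classical
  have : Fintype t := htf.fintype
  have hind : LinearIndependent ℚ (fun (x : t) i => ((x : ι → ℕ) i : ℚ)) := ht.natCast_rat
  obtain ⟨g, hg⟩ := LinearMap.exists_leftInverse_of_injective _ (LinearMap.ker_eq_bot.2 hind)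
  have hgv (b : t) : g (fun i => ((b : ι → ℕ) i : ℚ)) = Finsupp.single b 1 := by
    have := LinearMap.congr_fun hg (Finsupp.single b 1)
    simpa using this
  let r : t → ι → ℚ := fun b i => g (Pi.single i 1) b
  let q : ℕ := ∏ p : t × ι, (r p.1 p.2).den
  have hdvd (b : t) (i : ι) : (r b i).den ∣ q :=
    Finset.dvd_prod_of_mem (fun p : t × ι => (r p.1 p.2).den) (Finset.mem_univ (b, i))
  choose k hk using hdvd
  have hr (b : t) (i : ι) : (((r b i).num * k b i : ℤ) : ℚ) = q * r b i := by
    rw [hk b i]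
    push_cast
    rw [← Rat.den_mul_eq_num (r b i)]
    ring
  let l : t → ((ι → ℕ) →+ ℤ) := fun b =>
    { toFun := fun x => ∑ i, ((r b i).num * k b i : ℤ) * x i
      map_zero' := by simp
      map_add' := fun x y => by simp [mul_add, Finset.sum_add_distrib] }
  refine ⟨q, Finset.prod_pos fun p _ => Rat.den_pos _, l, fun b b' => ?_⟩
  have h1 : ((l b b' : ℤ) : ℚ) = q * g (fun i => ((b' : ι → ℕ) i : ℚ)) b := by
    have h2 : (fun i => ((b' : ι → ℕ) i : ℚ)) =
        ∑ i, ((b' : ι → ℕ) i : ℚ) • Pi.single i (1 : ℚ) := by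
      ext j
      simp [Finset.sum_apply, Pi.single_apply]
    rw [h2, map_sum, Finsupp.finsetSum_apply, Finset.mul_sum]
    simp only [l, AddMonoidHom.coe_mk, ZeroHom.coe_mk]
    rw [Int.cast_sum]
    refine Finset.sum_congr rfl fun i _ => ?_
    rw [Int.cast_mul, hr, map_smul]
    simp [r]
    ring
  rw [hgv] at h1
  by_cases hb : b' = b
  · subst hb
    simp only [Finsupp.single_eq_same, mul_one] at h1 ⊢
    exact_mod_cast h1
  · simp only [Finsupp.single_apply, hb, if_false] at h1 ⊢
    simpa using h1

theorem IsProperLinearSet.splitsUnambiguous {ι : Type} [Fintype ι] {s : Set (ι → ℕ)}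
    (hs : IsProperLinearSet s) : SplitsUnambiguous s := by
  classical
  obtain ⟨a, t, htf, ht, rfl⟩ := hs
  have : Fintype t := htf.fintype
  obtain ⟨q, hq, l, hl⟩ := ht.exists_dual htf
  have hmem (x : ι → ℕ) : x ∈ a +ᵥ (AddSubmonoid.closure t : Set (ι → ℕ)) ↔
      ∃ u : t → ℕ, x = a + ∑ b, u b • (b : ι → ℕ) := by
    rw [Set.mem_vadd_set]
    constructor
    · rintro ⟨y, hy, rfl⟩
      rw [SetLike.mem_coe, ← Subtype.range_coe (s := t), AddSubmonoid.mem_closure_range_iff] at hy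
      obtain ⟨u, rfl⟩ := hy
      exact ⟨u, by rw [Finsupp.sum_fintype]; · rfl
                   · simp⟩
    · rintro ⟨u, rfl⟩
      exact ⟨_, sum_mem fun b _ => nsmul_mem (AddSubmonoid.subset_closure b.2) _, rfl⟩
  let π (j : ι) : (ι → ℕ) →+ ℤ := (Nat.castAddMonoidHom ℤ).comp (Pi.evalAddMonoidHom _ j)
  let h (j : ι) : (ι → ℕ) →+ ℤ := q • π j - ∑ b : t, (b : ι → ℕ) j • l b
  have key : a +ᵥ (AddSubmonoid.closure t : Set (ι → ℕ)) =
      ({x | ∀ b, (q : ℤ) ∣ -l b a + l b x} ∩ {x | ∀ b, 0 ≤ -l b a + l b x}) ∩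
        {x | ∀ j, -h j a + h j x = 0} := by
    ext x
    rw [hmem]
    constructor
    · rintro ⟨u, rfl⟩
      have h1 (b : t) : l b (∑ b, u b • (b : ι → ℕ)) = q * u b := by
        simp only [map_sum, map_nsmul, hl, Finsupp.single_apply]
        simp [mul_comm]
      refine ⟨⟨fun b => ?_, fun b => ?_⟩, fun j => ?_⟩
      · rw [map_add, h1]
        simp
      · rw [map_add, h1]
        simp only [neg_add_cancel_left]
        positivity
      · rw [map_add, neg_add_cancel_left]
        simp only [h, AddMonoidHom.sub_apply, AddMonoidHom.nsmul_apply,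
          AddMonoidHom.finsetSum_apply, h1]
        simp [π, Finset.mul_sum]
        rw [sub_eq_zero]
        exact Finset.sum_congr rfl fun b _ => by ring
    · rintro ⟨⟨hx₁, hx₂⟩, hx₃⟩
      have h1 (b : t) : ∃ u : ℕ, -l b a + l b x = q * u := by
        obtain ⟨c, hc⟩ := hx₁ b
        have hc0 : 0 ≤ c := by
          have := hx₂ b
          rw [hc] at this
          exact nonneg_of_mul_nonneg_right this (by exact_mod_cast hq)
        exact ⟨c.toNat, by rw [hc, Int.toNat_of_nonneg hc0]⟩
      choose u hu using h1
      refine ⟨u, ?_⟩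
      ext j
      have h2 := hx₃ j
      simp only [h, AddMonoidHom.sub_apply, AddMonoidHom.nsmul_apply,
          AddMonoidHom.finsetSum_apply] at h2
      have h3 : ∑ b : t, (b : ι → ℕ) j • l b x - ∑ b : t, (b : ι → ℕ) j • l b a =
          q * ∑ b : t, (u b : ℤ) * (b : ι → ℕ) j := by
        rw [← Finset.sum_sub_distrib, Finset.mul_sum]
        refine Finset.sum_congr rfl fun b _ => ?_
        have := hu b
        rw [← nsmul_sub, show l b x - l b a = q * u b by rw [← this]; ring]
        simp
        ring
      have h4 : (q : ℤ) * (x j : ℤ) = q * (a j + ∑ b : t, (u b : ℤ) * (b : ι → ℕ) j) := by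
        rw [mul_add, ← h3]
        have ha : (q • π j) a = (q : ℤ) * a j := by simp [π]
        have hx : (q • π j) x = (q : ℤ) * x j := by simp [π]
        simp only [AddMonoidHom.nsmul_apply] at ha hx
        rw [ha, hx] at h2
        linarith
      have h5 := mul_left_cancel₀ (by exact_mod_cast hq.ne') h4
      zify
      simpa [Finset.sum_apply] using h5
  rw [key]
  exact ((SplitsUnambiguous.setOf_forall fun b => .congruence _ _ q hq).inter
    (SplitsUnambiguous.setOf_forall fun b => .halfspace _ _)).inter
    (SplitsUnambiguous.setOf_forall fun j => .hyperplane _ _)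

theorem IsSemilinearSet.isUnambiguous {ι : Type} [Fintype ι] {s : Set (ι → ℕ)}
    (hs : IsSemilinearSet s) : IsUnambiguous s := by
  obtain ⟨S, hS, hS', rfl⟩ := hs.isProperSemilinearSet
  simpa using (SplitsUnambiguous.sUnion hS fun t ht => (hS' t ht).splitsUnambiguous) _
    IsUnambiguous.univ |>.1

/-- A function that for large `n` agrees with one of finitely many rational polynomials, selected
by the residue of `n` modulo a fixed positive integer. -/
def EventuallyQuasiPolynomial (g : ℕ → ℕ) : Prop :=
  ∃ p : ℕ, 0 < p ∧ ∃ P : ℕ → ℚ[X], ∀ᶠ n in atTop, (g n : ℚ) = (P (n % p)).eval (n : ℚ)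

namespace EventuallyQuasiPolynomial

theorem isEQP {g : ℕ → ℕ} (hg : EventuallyQuasiPolynomial g) : IsEQP fun n => (g n : ℤ) := by
  obtain ⟨p, hp, P, hP⟩ := hg
  obtain ⟨N, hN⟩ := eventually_atTop.1 hP
  refine ⟨(Finset.range p).sup fun r => (P r).natDegree,
    fun i n => if N ≤ n then (P (n % p)).coeff i else if i = 0 then (g n : ℚ) else 0,
    fun i _ => ⟨N, p, hp, fun n hn => ?_⟩, fun n => ?_⟩
  · simp [hn, hn.trans (Nat.le_add_right n p)]
  · by_cases hn : N ≤ n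
    · have hdeg : (P (n % p)).natDegree ≤ (Finset.range p).sup fun r => (P r).natDegree :=
        Finset.le_sup (f := fun r => (P r).natDegree) (Finset.mem_range.2 (Nat.mod_lt n hp))
      simp only [hn, if_true, Int.cast_natCast]
      rw [hN n hn, eval_eq_sum_range' (Nat.lt_succ_of_le hdeg)]
    · simp [hn]

theorem congr {g h : ℕ → ℕ} (hg : EventuallyQuasiPolynomial g) (hgh : ∀ᶠ n in atTop, g n = h n) :
    EventuallyQuasiPolynomial h := by
  obtain ⟨p, hp, P, hP⟩ := hg
  refine ⟨p, hp, P, ?_⟩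
  filter_upwards [hP, hgh] with n h1 h2
  rw [← h2, h1]

theorem zero : EventuallyQuasiPolynomial fun _ => 0 :=
  ⟨1, one_pos, 0, by simp⟩

theorem add {g h : ℕ → ℕ} (hg : EventuallyQuasiPolynomial g) (hh : EventuallyQuasiPolynomial h) :
    EventuallyQuasiPolynomial fun n => g n + h n := by
  obtain ⟨p, hp, P, hP⟩ := hg
  obtain ⟨q, hq, Q, hQ⟩ := hh
  refine ⟨p * q, Nat.mul_pos hp hq, fun r => P (r % p) + Q (r % q), ?_⟩
  filter_upwards [hP, hQ] with n h1 h2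
  rw [Nat.cast_add, h1, h2, Nat.mod_mod_of_dvd _ (Dvd.intro _ rfl),
    Nat.mod_mod_of_dvd _ (Dvd.intro_left _ rfl), eval_add]

theorem sum {α : Type} {g : α → ℕ → ℕ} (s : Finset α)
    (hg : ∀ x ∈ s, EventuallyQuasiPolynomial (g x)) :
    EventuallyQuasiPolynomial fun n => ∑ x ∈ s, g x n := by
  classical
  induction s using Finset.induction_on with
  | empty => simpa using zero
  | insert x s hx ih =>
    simp only [Finset.sum_insert hx]
    exact (hg x (Finset.mem_insert_self x s)).add
      (ih fun y hy => hg y (Finset.mem_insert_of_mem hy))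

/-- Stars and bars. -/
theorem ncard_setOf_sum_eq {ι : Type} [Fintype ι] (m : ℕ) :
    {w : ι → ℕ | ∑ i, w i = m}.ncard = (Fintype.card ι).multichoose m := by
  classical
  rw [← Nat.card_coe_set_eq, ← Sym.card_sym_eq_multichoose, ← Nat.card_eq_fintype_card]
  exact (Nat.card_congr (Sym.equivNatSumOfFintype ι m)).symm

theorem ncard_setOf_add_mul_sum_eq {ι : Type} [Fintype ι] (e : ℕ) {c : ℕ} (hc : 0 < c) :
    EventuallyQuasiPolynomial fun n => {w : ι → ℕ | e + c * ∑ i, w i = n}.ncard := by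
  have hempty (n : ℕ) (h : ¬ n ≡ e [MOD c]) : {w : ι → ℕ | e + c * ∑ i, w i = n} = ∅ := by
    rw [Set.eq_empty_iff_forall_notMem]
    rintro w rfl
    exact h (by simp [Nat.ModEq])
  have hset (m : ℕ) : {w : ι → ℕ | e + c * ∑ i, w i = e + c * m} = {w | ∑ i, w i = m} := by
    ext w
    simp [hc.ne']
  rcases hk : Fintype.card ι with _ | k
  · refine zero.congr ?_
    filter_upwards [eventually_gt_atTop e] with n hn
    have : IsEmpty ι := Fintype.card_eq_zero_iff.1 hk
    simp [hn.ne]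
  · refine ⟨c, hc, fun r => if r ≡ e [MOD c] then
      (preHilbertPoly ℚ k 0).comp ((c : ℚ)⁻¹ • (X - C (e : ℚ))) else 0, ?_⟩
    filter_upwards [eventually_ge_atTop e] with n hn
    have hmod : n % c ≡ e [MOD c] ↔ n ≡ e [MOD c] := by simp [Nat.ModEq]
    by_cases h : n ≡ e [MOD c]
    · obtain ⟨m, hm⟩ := (Nat.modEq_iff_dvd' hn).1 h.symm
      obtain rfl : n = e + c * m := by omega
      have hc' : (c : ℚ) ≠ 0 := by exact_mod_cast hc.ne'
      have := preHilbertPoly_eq_choose_sub_add ℚ k (Nat.zero_le m)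
      rw [if_pos (hmod.2 h), hset, ncard_setOf_sum_eq, hk, Nat.multichoose_eq]
      simp only [eval_comp, eval_smul, eval_sub, eval_X, eval_C, smul_eq_mul]
      rw [show (c : ℚ)⁻¹ * (((e + c * m : ℕ) : ℚ) - e) = m by push_cast; field_simp; ring, this,
        Nat.sub_zero, show k + 1 + m - 1 = m + k by omega, Nat.choose_symm_add]
    · rw [if_neg (hmod.not.2 h), hempty n h]
      simp

theorem ncard_setOf_linear_eq {ι : Type} [Fintype ι] (e : ℕ) (c : ι → ℕ) (hc : ∀ i, 0 < c i) :
    EventuallyQuasiPolynomial fun n => {u : ι → ℕ | e + ∑ i, u i * c i = n}.ncard := by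
  classical
  let m : ι → ℕ := fun i => ∏ j ∈ Finset.univ.erase i, c j
  have hm (i : ι) : m i * c i = ∏ j, c j := Finset.prod_erase_mul _ _ (Finset.mem_univ i)
  have hm0 (i : ι) : 0 < m i := Finset.prod_pos fun j _ => hc j
  have hfin (n : ℕ) : {u : ι → ℕ | e + ∑ i, u i * c i = n}.Finite := by
    refine (Set.finite_Iic fun _ : ι => n).subset fun u hu i => ?_
    have h1 : u i * c i ≤ ∑ i, u i * c i :=
      Finset.single_le_sum (f := fun i => u i * c i) (fun _ _ => Nat.zero_le _) (Finset.mem_univ i)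
    have h2 := Nat.le_mul_of_pos_right (u i) (hc i)
    simp only [Set.mem_ofPred_eq] at hu
    change u i ≤ n
    omega
  refine (sum (Fintype.piFinset fun i => Finset.range (m i)) fun ρ _ =>
    ncard_setOf_add_mul_sum_eq (ι := ι) (e + ∑ i, ρ i * c i)
      (Finset.prod_pos fun j (_ : j ∈ Finset.univ) => hc j)).congr (.of_forall fun n => ?_)
  rw [Set.ncard_eq_toFinset_card _ (hfin n), Finset.card_eq_sum_card_fiberwise
    (f := fun u i => u i % m i) (t := Fintype.piFinset fun i => Finset.range (m i))]
  · refine Finset.sum_congr rfl fun ρ hρ => ?_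
    rw [← Set.ncard_coe_finset]
    simp only [Fintype.mem_piFinset, Finset.mem_range] at hρ
    refine Set.ncard_congr (fun w _ i => ρ i + m i * w i) ?_ ?_ ?_
    · intro w hw
      simp only [Set.mem_ofPred_eq, Finset.coe_filter, Set.Finite.mem_toFinset] at hw ⊢
      refine ⟨?_, funext fun i => by simp [Nat.mod_eq_of_lt (hρ i)]⟩
      rw [← hw, add_assoc, Finset.mul_sum, ← Finset.sum_add_distrib]
      congr 1
      refine Finset.sum_congr rfl fun i _ => ?_
      rw [← hm i]
      ring
    · intro w w' _ _ h
      funext i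
      have := congrFun h i
      simpa [(hm0 i).ne'] using this
    · intro u hu
      simp only [Set.mem_ofPred_eq, Finset.coe_filter, Set.Finite.mem_toFinset] at hu ⊢
      have hu' (i : ι) : ρ i + m i * (u i / m i) = u i := by
        rw [← hu.2]
        exact Nat.mod_add_div _ _
      refine ⟨fun i => u i / m i, ?_, funext hu'⟩
      rw [← hu.1, add_assoc, Finset.mul_sum, ← Finset.sum_add_distrib]
      congr 1
      refine Finset.sum_congr rfl fun i _ => ?_
      rw [← hm i]
      conv_rhs => rw [← hu' i]
      ring
  · intro u _
    simpa using fun i => Nat.mod_lt (u i) (hm0 i)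

end EventuallyQuasiPolynomial

theorem IsUnambiguous.eventuallyQuasiPolynomial_ncard {M : Type} [AddCommMonoid M] {s : Set M}
    (hs : IsUnambiguous s) (w : M →+ ℕ) (hfin : ∀ n, {x ∈ s | w x = n}.Finite) :
    EventuallyQuasiPolynomial fun n => {x ∈ s | w x = n}.ncard := by
  classical
  induction hs with
  | empty => simpa using EventuallyQuasiPolynomial.zero
  | @union s t hs ht hst ihs iht =>
    have hs' (n : ℕ) : {x ∈ s | w x = n}.Finite :=
      (hfin n).subset fun x hx => ⟨Or.inl hx.1, hx.2⟩
    have ht' (n : ℕ) : {x ∈ t | w x = n}.Finite :=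
      (hfin n).subset fun x hx => ⟨Or.inr hx.1, hx.2⟩
    refine ((ihs hs').add (iht ht')).congr (.of_forall fun n => ?_)
    rw [← Set.ncard_union_eq (hst.mono (fun x hx => hx.1) fun x hx => hx.1) (hs' n) (ht' n)]
    congr 1
    ext x
    simp only [Set.mem_union, Set.mem_ofPred_eq]
    tauto
  | @range ι _ a φ hφ =>
    have hw (u : ι → ℕ) : w (a + φ u) = w a + ∑ i, u i * w (φ (Pi.single i 1)) := by
      rw [map_add]
      congr 1
      simpa using addMonoidHom_apply_eq_sum (w.comp φ) u
    have hpos (i : ι) : 0 < w (φ (Pi.single i 1)) := by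
      by_contra h0
      refine Set.infinite_of_injective_forall_mem
        (s := {x ∈ Set.range fun u => a + φ u | w x = w a})
        (f := fun t : ℕ => a + φ (Pi.single i t)) ?_ (fun t => ⟨⟨_, rfl⟩, ?_⟩) (hfin (w a))
      · exact hφ.comp (Pi.single_injective i)
      · rw [hw]
        simp only [Nat.add_eq_left, Finset.sum_eq_zero_iff, Finset.mem_univ, true_imp_iff]
        intro j
        by_cases hj : j = i
        · subst hj
          simp only [Nat.pos_iff_ne_zero, not_not] at h0
          simp [h0]
        · simp [hj]
    refine (EventuallyQuasiPolynomial.ncard_setOf_linear_eq (w a) _ hpos).congr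
      (.of_forall fun n => ?_)
    rw [← Set.ncard_image_of_injective _ hφ]
    congr 1
    ext x
    simp only [Set.mem_image, Set.mem_ofPred_eq, Set.mem_range]
    constructor
    · rintro ⟨u, hu, rfl⟩
      exact ⟨⟨u, rfl⟩, by rw [hw, hu]⟩
    · rintro ⟨⟨u, rfl⟩, hu⟩
      exact ⟨u, by rw [← hw, hu], rfl⟩

theorem isSemilinearSet_setOf_lt {M : Type} [AddCommMonoid M] [AddMonoid.FG M] (l l' : M →+ ℕ) :
    IsSemilinearSet {x | l x < l' x} := by
  convert (isSemilinearSet_setOfPred_eq 1 0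
    (l.comp (AddMonoidHom.fst M ℕ) + AddMonoidHom.snd M ℕ)
    (l'.comp (AddMonoidHom.fst M ℕ))).image (AddMonoidHom.fst M ℕ) using 1
  ext x
  simp only [Set.mem_ofPred_eq, Set.mem_image, Prod.exists, AddMonoidHom.add_apply,
    AddMonoidHom.comp_apply, AddMonoidHom.coe_fst, AddMonoidHom.coe_snd]
  constructor
  · exact fun h => ⟨x, l' x - (l x + 1), by omega, rfl⟩
  · rintro ⟨y, t, h, rfl⟩
    omega

/-- Tuples consisting of a positive base `v none` and digits `v (some p)` in that base. -/
def digitBox (τ : Type) : Set (Option τ → ℕ) :=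
  {v | 0 < v none ∧ ∀ p, v (some p) < v none}

theorem isSemilinearSet_digitBox (τ : Type) [Finite τ] : IsSemilinearSet (digitBox τ) := by
  have h := (isSemilinearSet_setOf_lt 0 (Pi.evalAddMonoidHom (fun _ : Option τ => ℕ) none)).inter
    (IsSemilinearSet.iInter fun p : τ =>
      isSemilinearSet_setOf_lt (Pi.evalAddMonoidHom (fun _ : Option τ => ℕ) (some p))
        (Pi.evalAddMonoidHom (fun _ : Option τ => ℕ) none))
  convert h using 1
  ext v
  simp [digitBox]

theorem isSemilinearSet_digitBox_inter_of_coeff {τ : Type} [Fintype τ] (E : ℕ) (Q : τ → ℤ[X])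
    (Q₀ : ℤ[X]) (hQ : ∀ p, ∀ j, E ≤ j → (Q p).coeff j = 0) (hQ₀ : ∀ j, E < j → Q₀.coeff j = 0) :
    IsSemilinearSet {v ∈ digitBox τ |
      ∑ p, (Q p).eval (v none : ℤ) * v (some p) + Q₀.eval (v none : ℤ) = 0} := by
  induction E generalizing Q Q₀ with
  | zero =>
    obtain rfl : Q = 0 := funext fun p => Polynomial.ext fun j => hQ p j (Nat.zero_le j)
    obtain ⟨c, rfl⟩ : ∃ c, Q₀ = C c := ⟨_, eq_C_of_natDegree_le_zero
      (natDegree_le_iff_coeff_eq_zero.2 fun j hj => hQ₀ j hj)⟩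
    by_cases hc : c = 0
    · simpa [hc] using isSemilinearSet_digitBox τ
    · simp [hc]
  | succ E ih =>
    set m : ℤ := ∑ p, |(Q p).coeff 0| + |Q₀.coeff 0| with hm
    let A : (Option τ → ℕ) →+ ℤ := ∑ p, (AddMonoidHom.mulLeft ((Q p).coeff 0)).comp
      ((Nat.castAddMonoidHom ℤ).comp (Pi.evalAddMonoidHom _ (some p)))
    have hA (v : Option τ → ℕ) : A v = ∑ p, (Q p).coeff 0 * v (some p) := by
      simp [A, AddMonoidHom.finsetSum_apply]
    have hsplit (P : ℤ[X]) (x : ℤ) : P.eval x = P.divX.eval x * x + P.coeff 0 := by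
      conv_lhs => rw [← divX_mul_X_add P]
      simp
    have key : IsSemilinearSet (⋃ c ∈ Finset.Icc (-m) m,
        {v ∈ digitBox τ | ∑ p, (Q p).divX.eval (v none : ℤ) * v (some p) +
          (Q₀.divX + C c).eval (v none : ℤ) = 0} ∩
        {v | Q₀.coeff 0 + A v = 0 + ((AddMonoidHom.mulLeft c).comp
          ((Nat.castAddMonoidHom ℤ).comp (Pi.evalAddMonoidHom _ none)) :
            (Option τ → ℕ) →+ ℤ) v}) := by
      refine IsSemilinearSet.biUnion_finset fun c _ => (ih _ _ ?_ ?_).inter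
        (isSemilinearSet_setOfPred_eq _ _ _ _)
      · intro p j hj
        rw [coeff_divX]
        exact hQ p _ (by omega)
      · intro j hj
        rw [coeff_add, coeff_divX, hQ₀ _ (by omega), coeff_C, if_neg (by omega), add_zero]
    convert key using 1
    ext v
    have hsum : ∑ p, (Q p).eval (v none : ℤ) * v (some p) + Q₀.eval (v none : ℤ) =
        (∑ p, (Q p).divX.eval (v none : ℤ) * v (some p) + Q₀.divX.eval (v none : ℤ)) * v none +
          (Q₀.coeff 0 + A v) := by
      rw [hA, hsplit Q₀, add_mul, Finset.sum_mul]
      have : ∑ p, (Q p).eval (v none : ℤ) * v (some p) =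
          ∑ p, ((Q p).divX.eval (v none : ℤ) * v (some p) * v none +
            (Q p).coeff 0 * v (some p)) := by
        refine Finset.sum_congr rfl fun p _ => ?_
        rw [hsplit (Q p)]
        ring
      rw [this, Finset.sum_add_distrib]
      ring
    simp only [Set.mem_iUnion, Set.mem_inter_iff, Set.mem_ofPred_eq, exists_prop, Finset.mem_Icc,
      zero_add, AddMonoidHom.comp_apply, AddMonoidHom.coe_mulLeft, Nat.coe_castAddMonoidHom,
      Pi.evalAddMonoidHom_apply, eval_add, eval_C, hsum]
    constructor
    · rintro ⟨hv, h⟩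
      refine ⟨-(∑ p, (Q p).divX.eval (v none : ℤ) * v (some p) + Q₀.divX.eval (v none : ℤ)),
        ?_, ⟨hv, by ring⟩, by linarith⟩
      have hn : (0 : ℤ) < v none := by exact_mod_cast hv.1
      have hbound : |Q₀.coeff 0 + A v| ≤ m * v none := by
        rw [hA, hm, add_mul, add_comm, Finset.sum_mul]
        refine (abs_add_le _ _).trans (add_le_add ((Finset.abs_sum_le_sum_abs _ _).trans
          (Finset.sum_le_sum fun p _ => ?_)) (le_mul_of_one_le_right (abs_nonneg _) hn))
        rw [abs_mul, Nat.abs_cast]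
        exact mul_le_mul_of_nonneg_left (by exact_mod_cast (hv.2 p).le) (abs_nonneg _)
      rw [eq_neg_of_add_eq_zero_right h, ← neg_mul, abs_mul, Nat.abs_cast] at hbound
      exact abs_le.1 (le_of_mul_le_mul_right hbound hn)
    · rintro ⟨c, _, ⟨hv, h1⟩, h2⟩
      refine ⟨hv, ?_⟩
      rw [h2, ← add_mul, add_assoc, h1, zero_mul]

theorem isSemilinearSet_digitBox_inter {τ : Type} [Fintype τ] (Q : τ → ℤ[X]) (Q₀ : ℤ[X]) :
    IsSemilinearSet {v ∈ digitBox τ |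
      ∑ p, (Q p).eval (v none : ℤ) * v (some p) + Q₀.eval (v none : ℤ) = 0} := by
  refine isSemilinearSet_digitBox_inter_of_coeff
    ((Finset.univ.sup fun p => (Q p).natDegree) + 1 + Q₀.natDegree) Q Q₀ (fun p j hj => ?_)
    fun j hj => coeff_eq_zero_of_natDegree_lt (by omega)
  have := Finset.le_sup (f := fun p => (Q p).natDegree) (Finset.mem_univ p)
  exact coeff_eq_zero_of_natDegree_lt (by omega)

theorem exists_digits {D n y : ℕ} (hy : y < n ^ D) :
    ∃ d : Fin D → ℕ, (∀ j, d j < n) ∧ ∑ j, d j * n ^ (j : ℕ) = y :=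
  ⟨fun j => finFunctionFinEquiv.symm ⟨y, hy⟩ j, fun j => Fin.is_lt _, by
    rw [← finFunctionFinEquiv_apply, Equiv.apply_symm_apply]⟩

theorem sum_digits_lt {D n : ℕ} {d : Fin D → ℕ} (hd : ∀ j, d j < n) :
    ∑ j, d j * n ^ (j : ℕ) < n ^ D := by
  rw [← finFunctionFinEquiv_apply (fun j => (⟨d j, hd j⟩ : Fin n))]
  exact Fin.is_lt _

theorem digits_injective {D n : ℕ} {d d' : Fin D → ℕ} (hd : ∀ j, d j < n) (hd' : ∀ j, d' j < n)
    (h : ∑ j, d j * n ^ (j : ℕ) = ∑ j, d' j * n ^ (j : ℕ)) : d = d' := by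
  rw [← finFunctionFinEquiv_apply (fun j => (⟨d j, hd j⟩ : Fin n)),
    ← finFunctionFinEquiv_apply (fun j => (⟨d' j, hd' j⟩ : Fin n)), ← Fin.ext_iff,
    EmbeddingLike.apply_eq_iff_eq] at h
  funext j
  simpa using congrFun h j

/-- The number with the `D` base-`v none` digits `v (some (i, 0)), v (some (i, 1)), …`. -/
def digitValue {ι : Type} {D : ℕ} (v : Option (ι × Fin D) → ℕ) (i : ι) : ℕ :=
  ∑ j : Fin D, v (some (i, j)) * v none ^ (j : ℕ)

/-- The relation `R` between a positive `n` and a tuple of numbers below `n ^ D` is semilinear in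
terms of `n` and the base-`n` digits of the tuple. -/
def IsDigitSemilinear {ι : Type} (D : ℕ) (R : ℕ → (ι → ℕ) → Prop) : Prop :=
  IsSemilinearSet {v ∈ digitBox (ι × Fin D) | R (v none) (digitValue v)}

namespace IsDigitSemilinear

variable {ι κ : Type} {D : ℕ} {R S : ℕ → (ι → ℕ) → Prop}

theorem and (hR : IsDigitSemilinear D R) (hS : IsDigitSemilinear D S) :
    IsDigitSemilinear D fun n x => R n x ∧ S n x := by
  refine (congrArg IsSemilinearSet ?_).mp (IsSemilinearSet.inter hR hS)
  ext v
  simp only [Set.mem_inter_iff, Set.mem_ofPred_eq]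
  tauto

theorem not [Finite ι] (hR : IsDigitSemilinear D R) : IsDigitSemilinear D fun n x => ¬ R n x := by
  refine (congrArg IsSemilinearSet ?_).mp
    ((isSemilinearSet_digitBox (ι × Fin D)).inter (IsSemilinearSet.compl hR))
  ext v
  simp only [Set.mem_inter_iff, Set.mem_compl_iff, Set.mem_ofPred_eq]
  tauto

theorem linear_eq_zero [Fintype ι] (P : ι → ℤ[X]) (P₀ : ℤ[X]) : IsDigitSemilinear D fun n x =>
    ∑ i, (P i).eval (n : ℤ) * x i + P₀.eval (n : ℤ) = 0 := by
  refine (congrArg IsSemilinearSet ?_).mp (isSemilinearSet_digitBox_inter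
    (fun q : ι × Fin D => P q.1 * X ^ (q.2 : ℕ)) P₀)
  ext v
  simp only [Set.mem_ofPred_eq, Fintype.sum_prod_type, digitValue, Nat.cast_sum, Finset.mul_sum,
    eval_mul, eval_pow, eval_X, Nat.cast_mul, Nat.cast_pow, mul_assoc, mul_comm ((_ : ℤ) ^ _)]

theorem exists_lt {R : ℕ → (ι ⊕ κ → ℕ) → Prop} (hR : IsDigitSemilinear D R) :
    IsDigitSemilinear D fun n x => ∃ y : κ → ℕ, (∀ k, y k < n ^ D) ∧ R n (Sum.elim x y) := by
  let g : Option (ι × Fin D) → Option ((ι ⊕ κ) × Fin D) := Option.map (Prod.map Sum.inl id)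
  refine (congrArg IsSemilinearSet ?_).mp (IsSemilinearSet.image hR (LinearMap.funLeft ℕ ℕ g))
  ext v
  simp only [Set.mem_image, Set.mem_ofPred_eq]
  constructor
  · rintro ⟨u, ⟨hu, hRu⟩, rfl⟩
    refine ⟨⟨hu.1, fun p => hu.2 _⟩, fun k => digitValue u (Sum.inr k),
      fun k => sum_digits_lt fun j => hu.2 _, ?_⟩
    refine (congrArg (R (u none)) (funext fun i => ?_)).mp hRu
    rcases i with i | k <;> rfl
  · rintro ⟨hv, y, hy, hRy⟩
    choose d hd hdy using fun k => exists_digits (hy k)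
    let u : Option ((ι ⊕ κ) × Fin D) → ℕ
      | none => v none
      | some (Sum.inl i, j) => v (some (i, j))
      | some (Sum.inr k, j) => d k j
    refine ⟨u, ⟨⟨hv.1, ?_⟩, ?_⟩, ?_⟩
    · rintro ⟨i | k, j⟩
      · exact hv.2 (i, j)
      · exact hd k j
    · convert hRy using 1
      funext i
      rcases i with i | k
      · rfl
      · exact hdy k
    · funext p
      rcases p with _ | ⟨i, j⟩ <;> rfl

theorem eventuallyQuasiPolynomial_ncard {R : ℕ → (Unit → ℕ) → Prop} (hR : IsDigitSemilinear D R) :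
    EventuallyQuasiPolynomial fun n => {x | x < n ^ D ∧ R n fun _ => x}.ncard := by
  refine ((IsSemilinearSet.isUnambiguous hR).eventuallyQuasiPolynomial_ncard
    (Pi.evalAddMonoidHom _ none) fun n => ?_).congr ?_
  · refine (Set.finite_Iic fun _ : Option (Unit × Fin D) => n).subset ?_
    rintro v ⟨⟨hv, _⟩, rfl⟩ (_ | p)
    · exact le_rfl
    · exact (hv.2 p).le
  · filter_upwards [eventually_gt_atTop 0] with n hn
    refine Set.ncard_congr (fun v _ => digitValue v ()) ?_ ?_ ?_
    · rintro v ⟨⟨hv, hRv⟩, rfl⟩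
      exact ⟨sum_digits_lt fun j => hv.2 _, hRv⟩
    · rintro v w ⟨⟨hv, -⟩, rfl⟩ ⟨⟨hw, -⟩, hvw⟩ h
      simp only [Pi.evalAddMonoidHom_apply] at hvw
      simp only [digitValue, hvw] at h
      have := digits_injective (fun j => hv.2 ((), j)) (fun j => hvw ▸ hw.2 ((), j)) h
      funext p
      rcases p with _ | ⟨⟨⟩, j⟩
      · exact hvw.symm
      · exact congrFun this j
    · rintro x ⟨hx, hRx⟩
      obtain ⟨d, hd, hdx⟩ := exists_digits hx
      exact ⟨fun p => p.elim n fun q => d q.2,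
        ⟨⟨⟨hn, fun q => hd q.2⟩, (congrArg (R n) (funext fun _ => hdx.symm)).mp hRx⟩, rfl⟩, hdx⟩

end IsDigitSemilinear

namespace IsDigitSemilinear

variable {ι : Type} [Fintype ι] {D : ℕ}

theorem intLinear_eq_zero (q : ι → ℤ) (c : ℤ) :
    IsDigitSemilinear D fun _ x => ∑ i, q i * x i + c = 0 := by
  simpa using linear_eq_zero (D := D) (fun i => C (q i)) (C c)

end IsDigitSemilinear

/-- Some `z` with entries below `n ^ D` and sum `t` solves `∑ i, p i (n) * z i = P (n)`. -/
def HasFactorizationLT {k : ℕ} (p : Fin k → ℤ[X]) (P : ℤ[X]) (D n : ℕ) (t : ℤ) : Prop :=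
  ∃ z : Fin k → ℕ, (∀ i, z i < n ^ D) ∧ ∑ i, (p i).eval (n : ℤ) * z i = P.eval (n : ℤ) ∧
    ∑ i, (z i : ℤ) = t

theorem isDigitSemilinear_hasFactorizationLT {ι : Type} [Fintype ι] {k : ℕ} (p : Fin k → ℤ[X])
    (P : ℤ[X]) (D : ℕ) (q : ι → ℤ) :
    IsDigitSemilinear D fun n x => HasFactorizationLT p P D n (∑ i, q i * x i) := by
  have h := ((IsDigitSemilinear.linear_eq_zero (D := D) (Sum.elim (fun _ : ι => 0) p) (-P)).and
    (IsDigitSemilinear.intLinear_eq_zero (Sum.elim (fun i => -q i) fun _ : Fin k => 1) 0)).exists_lt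
  simp only [Fintype.sum_sum_type, Sum.elim_inl, Sum.elim_inr, eval_zero, zero_mul,
    Finset.sum_const_zero, zero_add, eval_neg, one_mul, add_zero, neg_mul,
    Finset.sum_neg_distrib, ← sub_eq_add_neg, sub_eq_zero, neg_add_eq_zero] at h
  simpa only [HasFactorizationLT, eq_comm] using h

theorem Polynomial.exists_eventually_eval_natCast_lt_pow (P : ℤ[X]) :
    ∃ D : ℕ, 0 < D ∧ ∀ᶠ n : ℕ in atTop, P.eval (n : ℤ) < (n : ℤ) ^ D := by
  refine ⟨P.natDegree + 1, Nat.succ_pos _, ?_⟩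
  filter_upwards [eventually_gt_atTop (∑ j ∈ Finset.range (P.natDegree + 1), |P.coeff j|).toNat]
    with n hn
  have hn1 : (1 : ℤ) ≤ n := by omega
  have hn2 : ∑ j ∈ Finset.range (P.natDegree + 1), |P.coeff j| < (n : ℤ) := by omega
  rw [eval_eq_sum_range, pow_succ']
  refine lt_of_le_of_lt ?_ (mul_lt_mul_of_pos_right hn2 (pow_pos (by omega) P.natDegree))
  rw [Finset.sum_mul]
  refine Finset.sum_le_sum fun j hj => mul_le_mul (le_abs_self _)
    (pow_le_pow_right₀ hn1 (Nat.lt_succ_iff.1 (Finset.mem_range.1 hj))) (by positivity)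
    (abs_nonneg _)

theorem Polynomial.eventually_eval_natCast_ne_zero_s11 {P : ℤ[X]} (hP : P ≠ 0) :
    ∀ᶠ n : ℕ in atTop, P.eval (n : ℤ) ≠ 0 := by
  rw [← Nat.cofinite_eq_atTop]
  exact Nat.cast_injective.tendsto_cofinite.eventually
    (P.finite_setOfPred_isRoot hP).eventually_cofinite_notMem

section DeltaSet

variable {k : ℕ} {f : Fin k → ℕ → ℕ} {a : ℕ → ℕ} {p : Fin k → ℤ[X]} {P : ℤ[X]} {D n : ℕ}

theorem hasFactorizationLT_iff_mem_lSet (hp : ∀ i, ∀ n : ℕ, (f i n : ℤ) = (p i).eval (n : ℤ))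
    (hP : ∀ n : ℕ, (a n : ℤ) = P.eval (n : ℤ)) (hpos : ∀ i, 0 < f i n) (hlt : a n < n ^ D)
    {ℓ : ℕ} : HasFactorizationLT p P D n ℓ ↔ ℓ ∈ LSet k f n (a n) := by
  have hle {z : Fin k → ℕ} (hz : ∑ i, z i * f i n = a n) (i : Fin k) : z i ≤ a n :=
    (Nat.le_mul_of_pos_right _ (hpos i)).trans (hz ▸
      Finset.single_le_sum (f := fun i => z i * f i n) (fun _ _ => Nat.zero_le _)
        (Finset.mem_univ i))
  simp only [HasFactorizationLT, LSet, Set.mem_ofPred_eq, ← hp, ← hP]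
  norm_cast
  simp only [mul_comm (f _ n)]
  exact ⟨fun ⟨z, _, h⟩ => ⟨z, h⟩, fun ⟨z, h⟩ => ⟨z, fun i => (hle h.1 i).trans_lt hlt, h⟩⟩

theorem le_of_mem_lSet (hpos : ∀ i, 0 < f i n) {m ℓ : ℕ} (hℓ : ℓ ∈ LSet k f n m) : ℓ ≤ m := by
  obtain ⟨z, rfl, rfl⟩ := hℓ
  exact Finset.sum_le_sum fun i _ => Nat.le_mul_of_pos_right _ (hpos i)

/-- A description of consecutive differences with all quantifiers bounded by `n ^ D`. -/
theorem deltaSetOf_eq_of_pos (hp : ∀ i, ∀ n : ℕ, (f i n : ℤ) = (p i).eval (n : ℤ))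
    (hP : ∀ n : ℕ, (a n : ℤ) = P.eval (n : ℤ)) (hpos : ∀ i, 0 < f i n) (hlt : a n < n ^ D) :
    DeltaSetOf k f n (a n) = {x | x < n ^ D ∧ x ≠ 0 ∧ ∃ y : Unit → ℕ, (∀ j, y j < n ^ D) ∧
      HasFactorizationLT p P D n (y ()) ∧ HasFactorizationLT p P D n (x + y ()) ∧
      ¬ ∃ w : Bool → ℕ, (∀ j, w j < n ^ D) ∧ w true ≠ 0 ∧ w false ≠ 0 ∧
        ((w true : ℤ) + w false = x ∧ HasFactorizationLT p P D n (y () + w true))} := by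
  have hmem {ℓ : ℕ} : HasFactorizationLT p P D n ℓ ↔ ℓ ∈ LSet k f n (a n) :=
    hasFactorizationLT_iff_mem_lSet hp hP hpos hlt
  ext x
  simp only [DeltaSetOf, Set.mem_ofPred_eq]
  norm_cast
  simp only [hmem]
  constructor
  · rintro ⟨ℓ, ℓ', hℓ, hℓ', hlt', rfl, hgap⟩
    have h1 := le_of_mem_lSet hpos hℓ'
    refine ⟨by omega, by omega, fun _ => ℓ, fun _ => by dsimp only; omega, hℓ, ?_, ?_⟩
    · rwa [Nat.sub_add_cancel hlt'.le]
    · rintro ⟨w, -, hw1, hw2, hw3, hw4⟩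
      exact hgap _ hw4 (by dsimp only; omega)
  · rintro ⟨hx, hx0, y, -, hy, hxy, hgap⟩
    refine ⟨y (), x + y (), hy, hxy, by omega, by omega, fun t ht htlt => hgap ?_⟩
    refine ⟨fun b => if b then t - y () else x + y () - t, ?_, ?_⟩
    · rintro (_ | _)
      · simp only [Bool.false_eq_true, if_false]
        omega
      · simp only [if_true]
        omega
    · simp only [Bool.false_eq_true, if_false, if_true]
      refine ⟨by omega, by omega, by omega, ?_⟩
      rwa [Nat.add_sub_cancel' htlt.1.le]

theorem deltaSetOf_eq_of_exists_zero (hp : ∀ i, ∀ n : ℕ, (f i n : ℤ) = (p i).eval (n : ℤ))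
    (hP : ∀ n : ℕ, (a n : ℤ) = P.eval (n : ℤ)) (hzero : ∃ i, f i n = 0) (hlt : a n < n ^ D)
    (hone : 1 < n ^ D) :
    DeltaSetOf k f n (a n) = {x | x < n ^ D ∧ x = 1 ∧ ∃ ℓ : Unit → ℕ, (∀ j, ℓ j < n ^ D) ∧
      HasFactorizationLT p P D n (ℓ ())} := by
  classical
  obtain ⟨i, hi⟩ := hzero
  have hsucc {ℓ : ℕ} (hℓ : ℓ ∈ LSet k f n (a n)) : ℓ + 1 ∈ LSet k f n (a n) := by
    obtain ⟨z, hz, rfl⟩ := hℓ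
    refine ⟨z + Pi.single i 1, ?_, ?_⟩
    · simp [add_mul, Finset.sum_add_distrib, hz, Pi.single_apply, hi]
    · simp [Finset.sum_add_distrib]
  simp only [HasFactorizationLT, ← hp, ← hP]
  ext x
  simp only [DeltaSetOf, Set.mem_ofPred_eq]
  norm_cast
  constructor
  · rintro ⟨ℓ, ℓ', hℓ, hℓ', hlt', rfl, hgap⟩
    have h1 := hgap _ (hsucc hℓ)
    obtain rfl : ℓ' = ℓ + 1 := by omega
    rw [Nat.add_sub_cancel_left]
    obtain ⟨z, hz, -⟩ := hℓ
    have hz' : ∑ j, f j n * (if f j n = 0 then 0 else z j) = a n := by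
      rw [← hz]
      refine Finset.sum_congr rfl fun j _ => ?_
      split_ifs with h <;> simp [h, mul_comm]
    have hle : ∑ j, (if f j n = 0 then 0 else z j) ≤ a n := by
      rw [← hz']
      refine Finset.sum_le_sum fun j _ => ?_
      split_ifs with h
      · simp
      · exact Nat.le_mul_of_pos_left _ (Nat.pos_of_ne_zero h)
    refine ⟨hone, rfl, fun _ => ∑ j, (if f j n = 0 then 0 else z j),
      fun _ => hle.trans_lt hlt, _, fun j => ?_, hz', rfl⟩
    exact ((Finset.single_le_sum (f := fun j => if f j n = 0 then 0 else z j)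
      (fun _ _ => Nat.zero_le _) (Finset.mem_univ j)).trans hle).trans_lt hlt
  · rintro ⟨-, rfl, ℓ, -, z, -, hz, hzℓ⟩
    have hℓ : ℓ () ∈ LSet k f n (a n) := ⟨z, by simpa only [mul_comm] using hz, hzℓ⟩
    exact ⟨ℓ (), ℓ () + 1, hℓ, hsucc hℓ, by omega, by omega, fun t _ => by omega⟩

end DeltaSet

theorem isDigitSemilinear_consecutive_difference {k : ℕ} (p : Fin k → ℤ[X]) (P : ℤ[X]) (D : ℕ) :
    IsDigitSemilinear D fun n (x : Unit → ℕ) => x () ≠ 0 ∧ ∃ y : Unit → ℕ, (∀ j, y j < n ^ D) ∧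
      HasFactorizationLT p P D n (y ()) ∧ HasFactorizationLT p P D n (x () + y ()) ∧
      ¬ ∃ w : Bool → ℕ, (∀ j, w j < n ^ D) ∧ w true ≠ 0 ∧ w false ≠ 0 ∧
        ((w true : ℤ) + w false = x () ∧ HasFactorizationLT p P D n (y () + w true)) := by
  have hx := (IsDigitSemilinear.intLinear_eq_zero (D := D) (fun _ : Unit => 1) 0).not
  have hy := isDigitSemilinear_hasFactorizationLT p P D
    (Sum.elim (fun _ => 0) fun _ => 1 : Unit ⊕ Unit → ℤ)
  have hxy := isDigitSemilinear_hasFactorizationLT p P D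
    (Sum.elim (fun _ => 1) fun _ => 1 : Unit ⊕ Unit → ℤ)
  have hw₁ := (IsDigitSemilinear.intLinear_eq_zero (D := D)
    (Sum.elim (fun _ => 0) fun b => if b then 1 else 0 : (Unit ⊕ Unit) ⊕ Bool → ℤ) 0).not
  have hw₂ := (IsDigitSemilinear.intLinear_eq_zero (D := D)
    (Sum.elim (fun _ => 0) fun b => if b then 0 else 1 : (Unit ⊕ Unit) ⊕ Bool → ℤ) 0).not
  have hsum := IsDigitSemilinear.intLinear_eq_zero (D := D) (Sum.elim
    (Sum.elim (fun _ => -1) fun _ => 0) fun _ => 1 : (Unit ⊕ Unit) ⊕ Bool → ℤ) 0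
  have hyw := isDigitSemilinear_hasFactorizationLT p P D (Sum.elim
    (Sum.elim (fun _ => 0) fun _ => 1) fun b => if b then 1 else 0 : (Unit ⊕ Unit) ⊕ Bool → ℤ)
  have h := hx.and (hy.and (hxy.and (hw₁.and (hw₂.and (hsum.and hyw))).exists_lt.not)).exists_lt
  simpa [neg_add_eq_zero, eq_comm] using h

theorem stmt11 (k : ℕ) (hk : 1 ≤ k) (f : Fin k → ℕ → ℕ)
    (hf : ∀ i, ∃ p : Polynomial ℤ, ∀ n : ℕ, (f i n : ℤ) = p.eval (n : ℤ))
    (a : ℕ → ℕ) (ha : ∃ p : Polynomial ℤ, ∀ n : ℕ, (a n : ℤ) = p.eval (n : ℤ)) :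
    IsEQP (fun n => ((DeltaSetOf k f n (a n)).ncard : ℤ)) := by
  choose p hp using hf
  obtain ⟨P, hP⟩ := ha
  obtain ⟨D, hD, hlt⟩ := P.exists_eventually_eval_natCast_lt_pow
  refine EventuallyQuasiPolynomial.isEQP (g := fun n => (DeltaSetOf k f n (a n)).ncard) ?_
  by_cases hzero : ∃ i, p i = 0
  · obtain ⟨i, hi⟩ := hzero
    have h := ((IsDigitSemilinear.intLinear_eq_zero (D := D) (fun _ : Unit => 1) (-1)).and
      (isDigitSemilinear_hasFactorizationLT p P D
        (Sum.elim (fun _ => 0) fun _ => 1 : Unit ⊕ Unit → ℤ)).exists_lt)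
    refine h.eventuallyQuasiPolynomial_ncard.congr ?_
    filter_upwards [hlt, eventually_gt_atTop 1] with n hn hn1
    rw [← hP] at hn
    rw [deltaSetOf_eq_of_exists_zero (D := D) hp hP
      ⟨i, by have := hp i n; rw [hi] at this; simpa using this⟩ (by exact_mod_cast hn)
      (Nat.one_lt_pow hD.ne' hn1)]
    simp [← sub_eq_add_neg, sub_eq_zero]
  · push Not at hzero
    refine (isDigitSemilinear_consecutive_difference p P
      D).eventuallyQuasiPolynomial_ncard.congr ?_
    filter_upwards [hlt, eventually_all.2 fun i => eventually_eval_natCast_ne_zero_s11 (hzero i)]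
      with n hn hne
    rw [← hP] at hn
    rw [deltaSetOf_eq_of_pos (D := D) hp hP (fun i => Nat.pos_of_ne_zero fun h => hne i ?_)
      (by exact_mod_cast hn)]
    rw [← hp, h, Nat.cast_zero]
end
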